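/- arXiv:1201.2883 — 3 statements merged into one kernel-verified Lean document; each statement's English description precedes it below -/
import Mathlib

section
/- Let g be a complete Riemannian metric without conjugate points on ℝ². Then there exists a Borel measurable and locally bounded function u : T¹×ℝ → ℝ with the following properties: for every v ∈ T¹ the function u_v(t) := u(v,t) is a solution of the Riccati equation along the geodesic γ_v with initial condition v, i.e. u_v'(t) + u_v(t)² + K(γ_v(t)) = 0 for all t ∈ ℝ; and u is invariant under the geodesic flow Φ, i.e. u(v, s+t) = u(Φ^s v, t) for all v ∈ T¹ and all s,t ∈ ℝ. -/
open MeasureTheory Filter Set Real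
open scoped ENNReal NNReal

noncomputable section

/-- Points / tangent vectors of the plane. -/
abbrev V2 : Type := Fin 2 → ℝ

/-- Componentwise velocity of a curve in the plane. -/
def vel (γ : ℝ → V2) (t : ℝ) : V2 := fun k => deriv (fun s => γ s k) t

/-- Componentwise acceleration of a curve in the plane. -/
def acc (γ : ℝ → V2) (t : ℝ) : V2 := fun k => deriv (fun s => vel γ s k) t

/-- The deck transformation `τⁿ(x,y) = (x+n,y)`. -/
def shift (n : ℤ) (p : V2) : V2 := p + (n : ℝ) • (Pi.single 0 1 : V2)

/-- A (smooth) Riemannian metric on the plane ℝ²: a smooth family of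
positive-definite symmetric matrices. -/
structure RMetric where
  g : V2 → Matrix (Fin 2) (Fin 2) ℝ
  smooth : ∀ i j, ContDiff ℝ (⊤ : ℕ∞) fun p => g p i j
  symm : ∀ p, (g p).IsSymm
  posDef : ∀ p, (g p).PosDef

/-- `B` has tangent direction `τ` at `p`. -/
def TangentDirAt (B : Set V2) (p τ : V2) : Prop :=
  τ ≠ 0 ∧ ∀ ε > 0, ∃ δ > 0, ∀ q ∈ B, q ≠ p → ‖q - p‖ < δ →
    ∃ s : ℝ, ‖q - p - s • τ‖ ≤ ε * ‖q - p‖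

/-- `B` is, near `x`, after a bi-Lipschitz change of coordinates, the graph of a
Lipschitz function. -/
def IsLipGraphAt (B : Set V2) (x : V2) : Prop :=
  ∃ U : Set V2, IsOpen U ∧ x ∈ U ∧
    ∃ (φ : V2 → ℝ × ℝ) (ψ : ℝ × ℝ → V2) (L : NNReal) (f : ℝ → ℝ),
      LipschitzOnWith L φ U ∧ LipschitzOnWith L ψ (φ '' U) ∧
      (∀ y ∈ U, ψ (φ y) = y) ∧ LipschitzWith L f ∧
      ∀ y ∈ U, (y ∈ B ↔ (φ y).2 = f (φ y).1)

/-- A (compact) 1-dimensional strong Lipschitz submanifold of the plane. -/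
def IsStrongLipschitzCurve (B : Set V2) : Prop := ∀ x ∈ B, IsLipGraphAt B x

/-- `Q` is the closure of its interior and its boundary `Q \ int Q` is a
1-dimensional strong Lipschitz submanifold. -/
def HasStrongLipschitzBoundary (Q : Set V2) : Prop :=
  Q = closure (interior Q) ∧ IsStrongLipschitzCurve (Q \ interior Q)

/-- Absolute continuity of `F` on `[a,b]`. -/
def AbsContOn (F : ℝ → ℝ) (a b : ℝ) : Prop :=
  ∀ ε > 0, ∃ δ > 0, ∀ n : ℕ, ∀ I : Fin n → ℝ × ℝ,
    (∀ i, a ≤ (I i).1 ∧ (I i).1 ≤ (I i).2 ∧ (I i).2 ≤ b) →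
    (∀ i j, i ≠ j → Disjoint (Set.Ioo (I i).1 (I i).2) (Set.Ioo (I j).1 (I j).2)) →
    (∑ i, ((I i).2 - (I i).1)) < δ → (∑ i, |F (I i).2 - F (I i).1|) < ε

/-- Local absolute continuity on a set: absolute continuity on every compact
subinterval. -/
def LocAbsContOn (F : ℝ → ℝ) (s : Set ℝ) : Prop :=
  ∀ a ∈ s, ∀ b ∈ s, a ≤ b → AbsContOn F a b

namespace RMetric

variable (M : RMetric)

/-- The inner product `g_p(v,w)`. -/
def met (p v w : V2) : ℝ := ∑ i, ∑ j, M.g p i j * v i * w j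

/-- The unit tangent bundle `T¹ = {(p,v) : g_p(v,v) = 1}`. -/
def UnitTangent : Set (V2 × V2) := {x | M.met x.1 x.2 x.2 = 1}

/-- Riemannian length of a `C¹` curve. -/
def curveLen (γ : ℝ → V2) (a b : ℝ) : ℝ :=
  ∫ t in a..b, Real.sqrt (M.met (γ t) (vel γ t) (vel γ t))

/-- The Riemannian distance: infimum of lengths of `C¹` curves joining the points. -/
def dist (p q : V2) : ℝ :=
  sInf {L | ∃ γ : ℝ → V2, ContDiff ℝ 1 γ ∧ γ 0 = p ∧ γ 1 = q ∧ L = M.curveLen γ 0 1}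

/-- Completeness of the induced metric space. -/
def Complete : Prop :=
  ∀ u : ℕ → V2, (∀ ε > 0, ∃ N, ∀ m ≥ N, ∀ n ≥ N, M.dist (u m) (u n) < ε) →
    ∃ p, Tendsto (fun n => M.dist (u n) p) atTop (nhds 0)

/-- Open metric ball. -/
def ball (p : V2) (r : ℝ) : Set V2 := {q | M.dist p q < r}

/-- Metric sphere. -/
def sphere (p : V2) (r : ℝ) : Set V2 := {q | M.dist p q = r}

/-- Coordinate derivative `∂_d g_{ij}`. -/
def dg (d i j : Fin 2) (p : V2) : ℝ :=
  deriv (fun s : ℝ => M.g (p + s • (Pi.single d 1 : V2)) i j) 0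

/-- Christoffel symbols `Γ^k_{ij}`. -/
def Γ (k i j : Fin 2) (p : V2) : ℝ :=
  (1 / 2) * ∑ l, (M.g p)⁻¹ k l * (M.dg i j l p + M.dg j i l p - M.dg l i j p)

/-- Coordinate derivative `∂_d Γ^k_{ij}`. -/
def dΓ (d k i j : Fin 2) (p : V2) : ℝ :=
  deriv (fun s : ℝ => M.Γ k i j (p + s • (Pi.single d 1 : V2))) 0

/-- Gaussian curvature `K = R_{1212} / det g`. -/
def K (p : V2) : ℝ :=
  (∑ l, M.g p 0 l *
      (M.dΓ 0 l 1 1 p - M.dΓ 1 l 0 1 p +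
        ∑ m, (M.Γ l 0 m p * M.Γ m 1 1 p - M.Γ l 1 m p * M.Γ m 0 1 p))) /
    (M.g p).det

/-- Flatness: vanishing Gaussian curvature. -/
def Flat : Prop := ∀ p, M.K p = 0

/-- A geodesic of `g`: a `C²` solution of the geodesic equation. -/
def IsGeodesic (γ : ℝ → V2) : Prop :=
  ContDiff ℝ 2 γ ∧
    ∀ t, ∀ k, acc γ t k + ∑ i, ∑ j, M.Γ k i j (γ t) * vel γ t i * vel γ t j = 0

/-- Unit-speed curve. -/
def UnitSpeed (γ : ℝ → V2) : Prop := ∀ t, M.met (γ t) (vel γ t) (vel γ t) = 1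

/-- No conjugate points: every nontrivial solution of the Jacobi equation along a
unit-speed geodesic vanishing at `a` vanishes nowhere else. -/
def NoConjugatePoints : Prop :=
  ∀ γ : ℝ → V2, M.IsGeodesic γ → M.UnitSpeed γ →
    ∀ J : ℝ → ℝ, ContDiff ℝ 2 J →
      (∀ t, deriv (deriv J) t + M.K (γ t) * J t = 0) →
      (∃ t₀, J t₀ ≠ 0) → ∀ a, J a = 0 → ∀ t, t ≠ a → J t ≠ 0

/-- Riemannian area measure: density `√(det g)` with respect to Lebesgue measure. -/
def area : Measure V2 := volume.withDensity fun p => ENNReal.ofReal (Real.sqrt (M.g p).det)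

/-- `Φ` is the geodesic flow of `g` on the unit tangent bundle. -/
def IsGeodesicFlow (Φ : V2 × V2 → ℝ → V2 × V2) : Prop :=
  ∀ x ∈ M.UnitTangent, Φ x 0 = x ∧ M.IsGeodesic (fun t => (Φ x t).1) ∧
    ∀ t : ℝ, (Φ x t).2 = vel (fun s => (Φ x s).1) t

/-- First vector of the Gram-Schmidt `g`-orthonormal frame. -/
def E1 (p : V2) : V2 :=
  (Real.sqrt (M.met p (Pi.single 0 1) (Pi.single 0 1)))⁻¹ • (Pi.single 0 1 : V2)

def w2 (p : V2) : V2 :=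
  (Pi.single 1 1 : V2) - (M.met p (Pi.single 1 1) (M.E1 p)) • M.E1 p

/-- Second vector of the Gram-Schmidt `g`-orthonormal frame. -/
def E2 (p : V2) : V2 := (Real.sqrt (M.met p (M.w2 p) (M.w2 p)))⁻¹ • M.w2 p

/-- The `g`-unit tangent vector at `p` of angle `θ` (arclength parametrization of
the `g_p`-unit circle). -/
def unitVec (p : V2) (θ : ℝ) : V2 := Real.cos θ • M.E1 p + Real.sin θ • M.E2 p

/-- The Liouville measure on the unit tangent bundle: locally the product of the
area measure with the arclength (angle) measure on the fibers; `σ_* μ = 2π A`. -/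
def liouville : Measure (V2 × V2) :=
  Measure.map (fun x : V2 × ℝ => (x.1, M.unitVec x.1 x.2))
    (M.area.prod (volume.restrict (Set.Ico 0 (2 * π))))

/-- Diameter with respect to the Riemannian distance. -/
def ediam (S : Set V2) : ℝ≥0∞ := ⨆ p ∈ S, ⨆ q ∈ S, ENNReal.ofReal (M.dist p q)

/-- 1-dimensional Hausdorff measure (as an outer-measure set function) with
respect to the Riemannian distance. -/
def H1 (S : Set V2) : ℝ≥0∞ :=
  ⨆ (δ : ℝ) (_ : 0 < δ),
    ⨅ (U : ℕ → Set V2) (_ : S ⊆ ⋃ n, U n) (_ : ∀ n, M.ediam (U n) ≤ ENNReal.ofReal δ),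
      ∑' n, M.ediam (U n)

/-- The "tube" in the unit tangent bundle over `S` with angles in `Θ`. -/
def tube (S : Set V2) (Θ : Set ℝ) : Set (V2 × V2) :=
  (fun x : V2 × ℝ => (x.1, M.unitVec x.1 x.2)) '' (S ×ˢ Θ)

/-- `ν` is the measure on `σ⁻¹(B)` which is locally the product of the
1-dimensional Hausdorff measure on `B` with the angle measure on the fibers. -/
def IsNuOn (B : Set V2) (ν : Measure (V2 × V2)) : Prop :=
  ν {x : V2 × V2 | x.1 ∉ B} = 0 ∧
    ∀ S : Set V2, ∀ Θ : Set ℝ, S ⊆ B → MeasurableSet Θ → Θ ⊆ Set.Ico 0 (2 * π) →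
      ν (M.tube S Θ) = M.H1 S * volume Θ

/-- Locally bounded function on the unit tangent bundle. -/
def LocBddUT (f : V2 × V2 → ℝ) : Prop :=
  ∀ R : ℝ, ∃ Cb : ℝ, ∀ x ∈ M.UnitTangent, ‖x.1‖ ≤ R → |f x| ≤ Cb

/-- Locally bounded function on `T¹ × ℝ`. -/
def LocBddHopf (u : (V2 × V2) × ℝ → ℝ) : Prop :=
  ∀ R : ℝ, ∃ Cb : ℝ, ∀ x ∈ M.UnitTangent, ‖x.1‖ ≤ R → ∀ t : ℝ, |t| ≤ R → |u (x, t)| ≤ Cb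

/-- The function `u` produced by E. Hopf's construction: Borel measurable, locally
bounded, solving the Riccati equation along every unit-speed geodesic, and
invariant under the geodesic flow. -/
def IsHopfSolution (Φ : V2 × V2 → ℝ → V2 × V2) (u : (V2 × V2) × ℝ → ℝ) : Prop :=
  Measurable u ∧ M.LocBddHopf u ∧
    (∀ x ∈ M.UnitTangent, ∀ t : ℝ,
      HasDerivAt (fun s => u (x, s)) (-(u (x, t)) ^ 2 - M.K ((Φ x t).1)) t) ∧
    ∀ x ∈ M.UnitTangent, ∀ s t : ℝ, u (x, s + t) = u (Φ x s, t)

/-- `n` is the inner (w.r.t. `Q`) unit normal of the curve `B` at `p`. -/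
def IsInnerUnitNormalAt (Q B : Set V2) (p n : V2) : Prop :=
  M.met p n n = 1 ∧ (∃ τ, TangentDirAt B p τ ∧ M.met p n τ = 0) ∧
    ∀ᶠ t in nhdsWithin (0 : ℝ) (Set.Ioi 0), p + t • n ∈ interior Q

end RMetric

/-- A Riemannian metric on the cylinder `C = S¹ × ℝ`, modeled by a metric on ℝ²
invariant under the translation `τ(x,y) = (x+1,y)`. -/
structure CylMetric where
  M : RMetric
  invariant : ∀ p, M.g (shift 1 p) = M.g p

/-- τ-invariant subsets of ℝ², i.e. subsets of the cylinder. -/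
def InvSet (S : Set V2) : Prop := ∀ p, p ∈ S ↔ shift 1 p ∈ S

/-- The fundamental strip `[0,1) × ℝ`. -/
def strip : Set V2 := {p : V2 | p 0 ∈ Set.Ico (0 : ℝ) 1}

namespace CylMetric

variable (C : CylMetric)

/-- The distance on the cylinder: `d(p,q) = min_n d̃(p̃, τⁿ q̃)`. -/
def cdist (p q : V2) : ℝ := ⨅ n : ℤ, C.M.dist p (shift n q)

/-- Metric ball in the cylinder. -/
def cball (p : V2) (r : ℝ) : Set V2 := {q | C.cdist p q < r}

/-- Metric sphere in the cylinder. -/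
def csphere (p : V2) (r : ℝ) : Set V2 := {q | C.cdist p q = r}

/-- Completeness of the cylinder. -/
def Complete : Prop :=
  ∀ u : ℕ → V2, (∀ ε > 0, ∃ N, ∀ m ≥ N, ∀ n ≥ N, C.cdist (u m) (u n) < ε) →
    ∃ p, Tendsto (fun n => C.cdist (u n) p) atTop (nhds 0)

/-- Area measure on the cylinder, computed in the fundamental strip. -/
def carea (S : Set V2) : ℝ≥0∞ := C.M.area (S ∩ strip)

/-- The length `l(p)` of a shortest non-contractible loop based at `p`:
`l(p) = min_{n ≠ 0} d̃(p̃, τⁿ p̃)`. -/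
def loopLen (p : V2) : ℝ := ⨅ n : {n : ℤ // n ≠ 0}, C.M.dist p (shift n.1 p)

/-- Diameter with respect to the cylinder distance. -/
def ediamC (S : Set V2) : ℝ≥0∞ := ⨆ p ∈ S, ⨆ q ∈ S, ENNReal.ofReal (C.cdist p q)

/-- 1-dimensional Hausdorff measure of a (τ-invariant) subset of the cylinder. -/
def cH1 (S : Set V2) : ℝ≥0∞ :=
  ⨆ (δ : ℝ) (_ : 0 < δ),
    ⨅ (U : ℕ → Set V2) (_ : S ∩ strip ⊆ ⋃ n, U n)
      (_ : ∀ n, C.ediamC (U n) ≤ ENNReal.ofReal δ),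
      ∑' n, C.ediamC (U n)

/-- Distance from a point to a set in the cylinder. -/
def cinfDist (p : V2) (S : Set V2) : ℝ := ⨅ q : S, C.cdist p (q : V2)

/-- A neighborhood of the end `ℰ₊` (`pos = true`) resp. `ℰ₋` (`pos = false`). -/
def EndNbhd (U : Set V2) (pos : Bool) : Prop :=
  InvSet U ∧ ∃ c : ℝ, 0 < c ∧ ∀ p : V2, (if pos then c < p 1 else p 1 < -c) → p ∈ U

/-- The end has subquadratic area growth. -/
def Subquadratic (pos : Bool) : Prop :=
  ∃ U : Set V2, EndNbhd U pos ∧ ∃ p : V2,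
    Filter.liminf (fun r : ℝ => C.carea (U ∩ C.cball p r) / ENNReal.ofReal (r ^ 2)) atTop = 0

/-- A sequence converging to the end `ℰ₊` resp. `ℰ₋`. -/
def TendstoEnd (p : ℕ → V2) (pos : Bool) : Prop :=
  Tendsto (fun i => p i 1) atTop (if pos then atTop else atBot)

/-- The end opens less than linearly. -/
def OpensLessThanLinearly (pos : Bool) : Prop :=
  ∃ p : ℕ → V2, TendstoEnd p pos ∧
    Tendsto (fun i => C.loopLen (p i) / C.cdist (p i) (p 0)) atTop (nhds 0)

/-- A ray in the cylinder. -/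
def IsRay (γ : ℝ → V2) : Prop := ∀ s ≥ (0:ℝ), ∀ t ≥ (0:ℝ), C.cdist (γ s) (γ t) = |s - t|

/-- A ray converging to the end `ℰ₊` resp. `ℰ₋`. -/
def RayToEnd (γ : ℝ → V2) (pos : Bool) : Prop :=
  C.IsRay γ ∧ Tendsto (fun t => γ t 1) atTop (if pos then atTop else atBot)

/-- A minimal geodesic line in the cylinder. -/
def IsMinimalLine (γ : ℝ → V2) : Prop :=
  C.M.IsGeodesic γ ∧ ∀ s t : ℝ, C.cdist (γ s) (γ t) = |s - t|

/-- The line joins the two ends of the cylinder. -/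
def JoinsEnds (γ : ℝ → V2) : Prop :=
  Tendsto (fun t : ℝ => γ t 1) atTop atTop ∧ Tendsto (fun t : ℝ => γ t 1) atBot atBot

/-- `b` is the Busemann function of the ray `γ`: `b(p) = lim_t (d(p,γ(t)) - t)`. -/
def IsBusemann (γ : ℝ → V2) (b : V2 → ℝ) : Prop :=
  ∀ p : V2, Tendsto (fun t : ℝ => C.cdist p (γ t) - t) atTop (nhds (b p))

end CylMetric

end

section ODE

variable {E : Type*} [NormedAddCommGroup E] [NormedSpace ℝ E]

theorem dist_le_of_autonomous_right [ProperSpace E] {F : E → E}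
    (hF : LocallyLipschitz F) {f : ℝ → E} (hf : ∀ t, HasDerivAt f (F (f t)) t) (T : ℝ) :
    ∃ L : ℝ≥0, ∀ g : ℝ → E, (∀ t, HasDerivAt g (F (g t)) t) →
      dist (f 0) (g 0) * exp (L * T) < 1 →
      ∀ t ∈ Icc 0 T, dist (f t) (g t) ≤ dist (f 0) (g 0) * exp (L * T) := by
  have hfc : Continuous f := continuous_iff_continuousAt.2 fun t => (hf t).continuousAt
  have hY : IsCompact (Metric.cthickening 1 (f '' Icc 0 T)) :=
    (isCompact_Icc.image hfc).cthickening
  obtain ⟨L, hL⟩ := LocallyLipschitzOn.exists_lipschitzOnWith_of_compact hY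
    (hF.locallyLipschitzOn (s := Metric.cthickening 1 (f '' Icc 0 T)))
  refine ⟨L, fun g hg h1 => ?_⟩
  have hgc : Continuous g := continuous_iff_continuousAt.2 fun t => (hg t).continuousAt
  have key : ∀ τ ∈ Icc 0 T, (∀ t ∈ Ico 0 τ, dist (f t) (g t) < 1) →
      ∀ t ∈ Icc 0 τ, dist (f t) (g t) ≤ dist (f 0) (g 0) * exp (L * T) := by
    intro τ hτ hlt t ht
    have hmem : ∀ t ∈ Ico 0 τ, f t ∈ f '' Icc 0 T := fun t ht =>
      mem_image_of_mem _ ⟨ht.1, ht.2.le.trans hτ.2⟩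
    have := dist_le_of_trajectories_ODE_of_mem (v := fun _ => F)
      (s := fun _ => Metric.cthickening 1 (f '' Icc 0 T)) (a := 0) (b := τ) (K := L)
      (fun _ _ => hL) hfc.continuousOn (fun t _ => (hf t).hasDerivWithinAt)
      (fun t ht => Metric.self_subset_cthickening _ (hmem t ht))
      hgc.continuousOn (fun t _ => (hg t).hasDerivWithinAt)
      (fun t ht => Metric.mem_cthickening_of_dist_le _ _ _ _ (hmem t ht)
        (by rw [dist_comm]; exact (hlt t ht).le)) le_rfl t ht
    refine this.trans ?_
    gcongr
    linarith [ht.2, hτ.2]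
  by_cases hex : ∃ t ∈ Icc 0 T, 1 ≤ dist (f t) (g t)
  · exfalso
    have hcpt : IsCompact (Icc 0 T ∩ {t | 1 ≤ dist (f t) (g t)}) :=
      isCompact_Icc.inter_right (isClosed_le continuous_const (hfc.dist hgc))
    obtain ⟨τ, ⟨hτ, hτ1⟩, hleast⟩ := hcpt.exists_isLeast hex
    have := key τ hτ (fun t ht => by
      by_contra! h
      exact absurd (hleast ⟨⟨ht.1, ht.2.le.trans hτ.2⟩, h⟩) (not_le.2 ht.2)) τ ⟨hτ.1, le_rfl⟩
    exact absurd (hτ1.trans this) (not_le.2 h1)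
  · push Not at hex
    intro t ht
    exact key T ⟨ht.1.trans ht.2, le_rfl⟩ (fun s hs => hex s ⟨hs.1, hs.2.le⟩) t ht

theorem dist_le_of_autonomous [ProperSpace E] {F : E → E}
    (hF : LocallyLipschitz F) {f : ℝ → E} (hf : ∀ t, HasDerivAt f (F (f t)) t) (T : ℝ) :
    ∃ B : ℝ, 0 < B ∧ ∀ g : ℝ → E, (∀ t, HasDerivAt g (F (g t)) t) →
      dist (f 0) (g 0) * B < 1 →
      ∀ t ∈ Icc (-T) T, dist (f t) (g t) ≤ dist (f 0) (g 0) * B := by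
  have hneg : ∀ g : ℝ → E, (∀ t, HasDerivAt g (F (g t)) t) →
      ∀ t, HasDerivAt (fun s => g (-s)) ((-F) (g (-t))) t := by
    intro g hg t
    simpa [Function.comp_def] using (hg (-t)).scomp t (hasDerivAt_neg t)
  have hF' : LocallyLipschitz (-F) := fun x => by
    obtain ⟨K, s, hs, h⟩ := hF x
    exact ⟨K, s, hs, h.neg⟩
  obtain ⟨L₁, h₁⟩ := dist_le_of_autonomous_right hF hf T
  obtain ⟨L₂, h₂⟩ := dist_le_of_autonomous_right hF' (hneg f hf) T
  refine ⟨max (exp (L₁ * T)) (exp (L₂ * T)), lt_max_of_lt_left (exp_pos _), fun g hg hlt t ht => ?_⟩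
  have hd : 0 ≤ dist (f 0) (g 0) := dist_nonneg
  have m₁ := mul_le_mul_of_nonneg_left (le_max_left (exp (L₁ * T)) (exp (L₂ * T))) hd
  have m₂ := mul_le_mul_of_nonneg_left (le_max_right (exp (L₁ * T)) (exp (L₂ * T))) hd
  rcases le_total 0 t with h0 | h0
  · exact (h₁ g hg (m₁.trans_lt hlt) t ⟨h0, ht.2⟩).trans m₁
  · have := h₂ (fun s => g (-s)) (hneg g hg) (by simpa using m₂.trans_lt hlt) (-t)
      ⟨by linarith, by linarith [ht.1]⟩
    simp only [neg_neg, neg_zero] at this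
    exact this.trans m₂

theorem eq_of_autonomous [ProperSpace E] {F : E → E}
    (hF : LocallyLipschitz F) {f g : ℝ → E} (hf : ∀ t, HasDerivAt f (F (f t)) t)
    (hg : ∀ t, HasDerivAt g (F (g t)) t) (h0 : f 0 = g 0) : f = g := by
  funext t
  obtain ⟨B, -, h⟩ := dist_le_of_autonomous hF hf |t|
  have := h g hg (by simp [h0]) t ⟨neg_abs_le t, le_abs_self t⟩
  simpa [h0] using this

theorem continuous_of_autonomous [ProperSpace E] {X : Type*} [TopologicalSpace X] {F : E → E}
    (hF : LocallyLipschitz F) {y : X → ℝ → E} (hy : ∀ x t, HasDerivAt (y x) (F (y x t)) t)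
    (h0 : Continuous fun x => y x 0) : Continuous fun p : X × ℝ => y p.1 p.2 := by
  rw [continuous_iff_continuousAt]
  rintro ⟨x, t⟩
  obtain ⟨B, hB, h⟩ := dist_le_of_autonomous hF (hy x) (|t| + 1)
  have hlim : Tendsto (fun p : X × ℝ => dist (y x 0) (y p.1 0) * B) (nhds (x, t)) (nhds 0) := by
    have : Continuous fun p : X × ℝ => dist (y x 0) (y p.1 0) * B :=
      (continuous_const.dist (h0.comp continuous_fst)).mul continuous_const
    simpa using this.tendsto (x, t)
  have ht : ∀ᶠ p : X × ℝ in nhds (x, t), p.2 ∈ Icc (-(|t| + 1)) (|t| + 1) := by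
    have : Icc (-(|t| + 1)) (|t| + 1) ∈ nhds t :=
      Icc_mem_nhds (by linarith [neg_abs_le t]) (by linarith [le_abs_self t])
    exact (continuous_snd.tendsto (x, t)).eventually this
  have hd : Tendsto (fun p : X × ℝ => dist (y x p.2) (y p.1 p.2)) (nhds (x, t)) (nhds 0) := by
    refine tendsto_of_tendsto_of_tendsto_of_le_of_le' tendsto_const_nhds hlim
      (Eventually.of_forall fun _ => dist_nonneg) ?_
    filter_upwards [ht, hlim.eventually (gt_mem_nhds one_pos)] with p hp hp1
    exact h _ (hy p.1) hp1 _ hp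
  have hc : Tendsto (fun p : X × ℝ => y x p.2) (nhds (x, t)) (nhds (y x t)) :=
    (hy x t).continuousAt.tendsto.comp (continuous_snd.tendsto (x, t))
  exact tendsto_of_tendsto_of_dist hc hd

theorem exists_linear_ODE_solution [CompleteSpace E] {A : ℝ → E →L[ℝ] E} (hA : Continuous A)
    (y₀ : E) : ∃ y : ℝ → E, y 0 = y₀ ∧ ∀ t, HasDerivAt y (A t (y t)) t := by
  let c : ℕ → ℝ → E := fun n => n.rec (fun _ => y₀) fun _ f t => ∫ s in (0 : ℝ)..t, A s (f s)
  have hcs : ∀ n t, c (n + 1) t = ∫ s in (0 : ℝ)..t, A s (c n s) := fun _ _ => rfl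
  have hcc : ∀ n, Continuous (c n) := by
    intro n
    induction n with
    | zero => exact continuous_const
    | succ n ih =>
      exact intervalIntegral.continuous_primitive
        (fun a b => (hA.clm_apply ih).intervalIntegrable a b) 0
  have hcd : ∀ n t, HasDerivAt (c (n + 1)) (A t (c n t)) t := fun n t =>
    intervalIntegral.integral_hasDerivAt_right ((hA.clm_apply (hcc n)).intervalIntegrable _ _)
      (hA.clm_apply (hcc n)).stronglyMeasurable.stronglyMeasurableAtFilter
      (hA.clm_apply (hcc n)).continuousAt
  have hc0 : ∀ n, c (n + 1) 0 = 0 := fun n => by simp [hcs]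
  have bound : ∀ T : ℝ, ∃ M : ℝ, 0 ≤ M ∧ (∀ t ∈ Icc (-T) T, ‖A t‖ ≤ M) ∧
      ∀ n, ∀ t ∈ Icc (-T) T, ‖c n t‖ ≤ ‖y₀‖ * ((M * |t|) ^ n / n.factorial) := by
    intro T
    obtain ⟨M, hM⟩ := (isCompact_Icc (a := -T) (b := T)).exists_bound_of_continuousOn
      hA.continuousOn
    refine ⟨|M|, abs_nonneg _, fun t ht => (hM t ht).trans (le_abs_self M), fun n => ?_⟩
    induction n with
    | zero => intro t _; simp [c]
    | succ n ih =>
      intro t ht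
      have hbd : ∀ s ∈ uIoc 0 t, ‖A s (c n s)‖ ≤
          |M| * (‖y₀‖ * ((|M| * |s|) ^ n / n.factorial)) := by
        intro s hs
        have hs' : s ∈ Icc (-T) T := by
          rcases le_total 0 t with h | h
          · rw [uIoc_of_le h] at hs
            exact ⟨by linarith [ht.2, hs.1, hs.2], hs.2.trans ht.2⟩
          · rw [uIoc_of_ge h] at hs
            exact ⟨by linarith [ht.1, hs.1], by linarith [ht.1, hs.1, hs.2]⟩
        exact (A s).le_of_opNorm_le_of_le ((hM s hs').trans (le_abs_self M)) (ih s hs')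
      rw [hcs]
      have key : ∀ t : ℝ, 0 ≤ t → ∫ s in (0:ℝ)..t, |M| * (‖y₀‖ * ((|M| * |s|) ^ n / n.factorial)) =
          ‖y₀‖ * ((|M| * |t|) ^ (n + 1) / (n + 1).factorial) := by
        intro t ht
        have : ∀ s ∈ uIcc 0 t, |M| * (‖y₀‖ * ((|M| * |s|) ^ n / n.factorial)) =
            (|M| ^ (n + 1) * ‖y₀‖ / n.factorial) * s ^ n := by
          intro s hs
          rw [uIcc_of_le ht] at hs
          rw [abs_of_nonneg hs.1]; ring
        rw [intervalIntegral.integral_congr this, intervalIntegral.integral_const_mul, integral_pow,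
          abs_of_nonneg ht, Nat.factorial_succ]
        have : (n.factorial : ℝ) ≠ 0 := by positivity
        push_cast
        field_simp
        simp only [zero_pow (Nat.succ_ne_zero n), sub_zero]
        ring
      rcases le_total 0 t with h | h
      · rw [← key t h]
        refine intervalIntegral.norm_integral_le_of_norm_le h ?_ ?_
        · exact Eventually.of_forall fun s hs => hbd s (by rwa [uIoc_of_le h])
        · exact Continuous.intervalIntegrable (by fun_prop) _ _
      · rw [intervalIntegral.integral_symm, norm_neg]
        have e : ∫ s in t..0, |M| * (‖y₀‖ * ((|M| * |s|) ^ n / n.factorial)) =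
            ‖y₀‖ * ((|M| * |t|) ^ (n + 1) / (n + 1).factorial) := by
          have := intervalIntegral.integral_comp_neg (a := 0) (b := -t)
            (fun s => |M| * (‖y₀‖ * ((|M| * |s|) ^ n / n.factorial)))
          simp only [neg_neg, neg_zero, abs_neg] at this
          rw [← this, key _ (by linarith), abs_neg]
        rw [← e]
        refine intervalIntegral.norm_integral_le_of_norm_le h ?_ ?_
        · exact Eventually.of_forall fun s hs => hbd s (by rwa [uIoc_of_ge h])
        · exact Continuous.intervalIntegrable (by fun_prop) _ _
  have bound' : ∀ T : ℝ, ∃ M : ℝ, 0 ≤ M ∧ (∀ t ∈ Icc (-T) T, ‖A t‖ ≤ M) ∧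
      ∀ n, ∀ t ∈ Icc (-T) T, ‖c n t‖ ≤ ‖y₀‖ * ((M * T) ^ n / n.factorial) := by
    intro T
    obtain ⟨M, h0, h1, h2⟩ := bound T
    refine ⟨M, h0, h1, fun n t ht => (h2 n t ht).trans ?_⟩
    gcongr
    exact abs_le.2 ht
  have hsum : ∀ t, Summable fun n => c n t := by
    intro t
    obtain ⟨M, -, -, h⟩ := bound' |t|
    exact .of_norm_bounded ((Real.summable_pow_div_factorial (M * |t|)).mul_left ‖y₀‖)
      fun n => h n t ⟨neg_abs_le t, le_abs_self t⟩
  refine ⟨fun t => ∑' n, c n t, ?_, fun t => ?_⟩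
  · show ∑' n, c n 0 = y₀
    rw [(hsum 0).tsum_eq_zero_add]
    simp only [hc0, tsum_zero, add_zero]
    rfl
  · obtain ⟨M, hM0, hM, h⟩ := bound' (|t| + 1)
    have hder : HasDerivAt (fun z => ∑' n, c (n + 1) z) (∑' n, A t (c n t)) t := by
      refine hasDerivAt_tsum_of_isPreconnected (t := Ioo (-(|t| + 1)) (|t| + 1))
        (((Real.summable_pow_div_factorial (M * (|t| + 1))).mul_left ‖y₀‖).mul_left M)
        isOpen_Ioo isPreconnected_Ioo (fun n s _ => hcd n s) (fun n s hs => ?_) (y₀ := t)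
        ?_ ((summable_nat_add_iff 1).2 (hsum t)) ?_
      · have hs' := Ioo_subset_Icc_self hs
        exact (A s).le_of_opNorm_le_of_le (hM s hs') (h n s hs')
      all_goals exact ⟨by linarith [neg_abs_le t], by linarith [le_abs_self t]⟩
    have e : (fun t => ∑' n, c n t) = fun t => y₀ + ∑' n, c (n + 1) t := by
      funext t
      rw [(hsum t).tsum_eq_zero_add]
      rfl
    rw [(A t).map_tsum (hsum t), e]
    exact hder.const_add y₀

end ODE

/-- `J` solves the Jacobi equation `J'' + k J = 0` and `J'` is its derivative. -/
def IsJacobi (k J J' : ℝ → ℝ) : Prop :=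
  ∀ t, HasDerivAt J (J' t) t ∧ HasDerivAt J' (-(k t * J t)) t

/-- No nontrivial solution of `J'' + k J = 0` has two zeros. -/
def Disconjugate (k : ℝ → ℝ) : Prop :=
  ∀ J J', IsJacobi k J J' → (∃ t, J t ≠ 0) → ∀ a, J a = 0 → ∀ t, t ≠ a → J t ≠ 0

/-- `C`, `S` is the fundamental system of `J'' + k J = 0` at `0`. -/
structure IsFundamental (k C C' S S' : ℝ → ℝ) : Prop where
  jacC : IsJacobi k C C'
  jacS : IsJacobi k S S'
  C0 : C 0 = 1
  C'0 : C' 0 = 0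
  S0 : S 0 = 0
  S'0 : S' 0 = 1

namespace IsJacobi

variable {k J J' H H' : ℝ → ℝ}

theorem continuous (h : IsJacobi k J J') : Continuous J :=
  continuous_iff_continuousAt.2 fun t => (h t).1.continuousAt

theorem comb (h : IsJacobi k J J') (h' : IsJacobi k H H') (a b : ℝ) :
    IsJacobi k (fun t => a * J t + b * H t) (fun t => a * J' t + b * H' t) := fun t =>
  ⟨((h t).1.const_mul a).add ((h' t).1.const_mul b),
    (((h t).2.const_mul a).add ((h' t).2.const_mul b)).congr_deriv (by ring)⟩

theorem shift (h : IsJacobi k J J') (s : ℝ) :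
    IsJacobi (fun t => k (s + t)) (fun t => J (s + t)) (fun t => J' (s + t)) := fun t =>
  ⟨(h (s + t)).1.comp_const_add s t, (h (s + t)).2.comp_const_add s t⟩

theorem wronskian (h : IsJacobi k J J') (h' : IsJacobi k H H') (t : ℝ) :
    J t * H' t - J' t * H t = J 0 * H' 0 - J' 0 * H 0 := by
  have hd : ∀ t, HasDerivAt (fun t => J t * H' t - J' t * H t) 0 t := fun t =>
    (((h t).1.mul (h' t).2).sub ((h t).2.mul (h' t).1)).congr_deriv (by ring)
  exact is_const_of_deriv_eq_zero (fun t => (hd t).differentiableAt) (fun t => (hd t).deriv) t 0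

end IsJacobi

namespace IsFundamental

variable {k C C' S S' J J' : ℝ → ℝ}

theorem eq_comb (h : IsFundamental k C C' S S') (hJ : IsJacobi k J J') (t : ℝ) :
    J t = J 0 * C t + J' 0 * S t := by
  have h1 := hJ.wronskian h.jacC t
  have h2 := hJ.wronskian h.jacS t
  have h3 := h.jacC.wronskian h.jacS t
  simp only [h.C0, h.C'0, h.S0, h.S'0] at h1 h2 h3
  linear_combination C t * h2 - S t * h1 - J t * h3

theorem jac_sub (h : IsFundamental k C C' S S') (a : ℝ) :
    IsJacobi k (fun t => C t - a * S t) (fun t => C' t - a * S' t) := by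
  simpa [sub_eq_add_neg] using h.jacC.comb h.jacS 1 (-a)

theorem S_ne_zero (h : IsFundamental k C C' S S') (hk : Disconjugate k) {t : ℝ} (ht : t ≠ 0) :
    S t ≠ 0 := by
  refine hk S S' h.jacS ?_ 0 h.S0 t ht
  by_contra! hz
  have := (h.jacS 0).1
  rw [show S = fun _ => 0 from funext hz, h.S'0] at this
  exact one_ne_zero (this.unique (hasDerivAt_const 0 0))

theorem S_div_pos (h : IsFundamental k C C' S S') (hk : Disconjugate k) {t : ℝ} (ht : t ≠ 0) :
    0 < S t / t := by
  have hd := (h.jacS 0).1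
  rw [h.S'0, hasDerivAt_iff_tendsto_slope] at hd
  have hev : ∀ᶠ s in nhdsWithin (0 : ℝ) {0}ᶜ, 0 < slope S 0 s := hd.eventually (lt_mem_nhds one_pos)
  simp only [slope_def_field, h.S0, sub_zero] at hev
  rw [eventually_nhdsWithin_iff, Metric.eventually_nhds_iff] at hev
  obtain ⟨ε, hε, hev⟩ := hev
  have key : ∀ σ : ℝ, (σ = 1 ∨ σ = -1) → ∀ r : ℝ, 0 < r → 0 < S (σ * r) / (σ * r) := by
    intro σ hσ r hr
    have hσ0 : σ ≠ 0 := by rcases hσ with rfl | rfl <;> norm_num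
    have hσ1 : |σ| = 1 := by rcases hσ with rfl | rfl <;> norm_num
    by_contra! hneg
    have hlt : 0 < min r (ε / 2) := lt_min hr (by linarith)
    have hpos := @hev (σ * min r (ε / 2)) (by
      rw [dist_zero_right, norm_mul, Real.norm_eq_abs, Real.norm_eq_abs, hσ1, abs_of_pos hlt]
      linarith [min_le_right r (ε / 2)]) (mul_ne_zero hσ0 hlt.ne')
    have hcont : ContinuousOn (fun r => S (σ * r) / (σ * r)) (Icc (min r (ε / 2)) r) :=
      (h.jacS.continuous.comp (continuous_const.mul continuous_id)).continuousOn.div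
        (by fun_prop) fun s hs => mul_ne_zero hσ0 (hlt.trans_le hs.1).ne'
    obtain ⟨s, hs, hs0⟩ := intermediate_value_Icc' (min_le_left r (ε / 2)) hcont ⟨hneg, hpos.le⟩
    have hs' : σ * s ≠ 0 := mul_ne_zero hσ0 (hlt.trans_le hs.1).ne'
    exact (div_ne_zero (h.S_ne_zero hk hs') hs') hs0
  rcases lt_or_gt_of_ne ht with h' | h'
  · simpa using key (-1) (Or.inr rfl) (-t) (by linarith)
  · simpa using key 1 (Or.inl rfl) t h'

theorem S_pos (h : IsFundamental k C C' S S') (hk : Disconjugate k) {t : ℝ} (ht : 0 < t) :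
    0 < S t := by
  have := h.S_div_pos hk ht.ne'
  rwa [div_pos_iff_of_pos_right ht] at this

theorem S_neg (h : IsFundamental k C C' S S') (hk : Disconjugate k) {t : ℝ} (ht : t < 0) :
    S t < 0 := by
  have := h.S_div_pos hk ht.ne
  by_contra! h0
  exact absurd this (not_lt.2 (div_nonpos_of_nonneg_of_nonpos h0 ht.le))

/-- The solution with value `1` at `0` that vanishes at `T` is positive on the side of `T`
containing `0`. -/
theorem sub_pos_of_zero (h : IsFundamental k C C' S S') (hk : Disconjugate k) {T t : ℝ}
    (hT : T ≠ 0) (ht : T ∉ uIcc 0 t) : 0 < C t - C T / S T * S t := by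
  have hne : ∀ s, s ≠ T → C s - C T / S T * S s ≠ 0 :=
    hk _ _ (h.jac_sub (C T / S T)) ⟨0, by simp [h.C0, h.S0]⟩ T
      (by field_simp [h.S_ne_zero hk hT]; ring)
  by_contra! hneg
  have hcont := (h.jac_sub (C T / S T)).continuous
  obtain ⟨s, hs, hs0⟩ := intermediate_value_uIcc (hcont.continuousOn (s := uIcc 0 t))
    (show (0 : ℝ) ∈ _ by
      rw [mem_uIcc]; right
      exact ⟨hneg, by simp [h.C0, h.S0]⟩)
  exact hne s (fun e => ht (e ▸ hs)) hs0

theorem quot_lt_of_neg_of_pos (h : IsFundamental k C C' S S') (hk : Disconjugate k) {a b : ℝ}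
    (ha : a < 0) (hb : 0 < b) : C a / S a < C b / S b := by
  have := h.sub_pos_of_zero hk ha.ne (t := b)
    (by rw [uIcc_of_le hb.le]; exact fun h => by linarith [h.1])
  rw [lt_div_iff₀ (h.S_pos hk hb)]
  linarith

theorem quot_lt_of_pos (h : IsFundamental k C C' S S') (hk : Disconjugate k) {a b : ℝ}
    (ha : 0 < a) (hab : a < b) : C b / S b < C a / S a := by
  have := h.sub_pos_of_zero hk (ha.trans hab).ne' (t := a)
    (by rw [uIcc_of_le ha.le]; exact fun h => by linarith [h.2])
  rw [lt_div_iff₀ (h.S_pos hk ha)]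
  linarith

theorem quot_lt_of_neg (h : IsFundamental k C C' S S') (hk : Disconjugate k) {a b : ℝ}
    (hab : a < b) (hb : b < 0) : C b / S b < C a / S a := by
  have := h.sub_pos_of_zero hk (hab.trans hb).ne (t := b)
    (by rw [uIcc_of_ge hb.le]; exact fun h => by linarith [h.1])
  rw [div_lt_iff_of_neg (h.S_neg hk hb)]
  linarith

theorem exists_tendsto_quot (h : IsFundamental k C C' S S') (hk : Disconjugate k) :
    ∃ r, Tendsto (fun t => C t / S t) atTop (nhds r) := by
  let q : ℝ → ℝ := fun t => C (max t 1) / S (max t 1)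
  have hanti : Antitone q := by
    intro a b hab
    rcases (max_le_max_right 1 hab).eq_or_lt with he | hl
    · simp only [q]; rw [he]
    · exact (h.quot_lt_of_pos hk (by positivity) hl).le
  have hbdd : BddBelow (range q) := ⟨C (-1) / S (-1), by
    rintro _ ⟨t, rfl⟩
    exact (h.quot_lt_of_neg_of_pos hk (by norm_num) (by positivity)).le⟩
  refine ⟨_, (tendsto_atTop_ciInf hanti hbdd).congr' ?_⟩
  filter_upwards [eventually_ge_atTop 1] with t ht
  simp only [q]; rw [max_eq_left ht]

variable {r : ℝ}

theorem lim_lt (h : IsFundamental k C C' S S') (hk : Disconjugate k)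
    (hr : Tendsto (fun t => C t / S t) atTop (nhds r)) {t : ℝ} (ht : 0 < t) : r < C t / S t := by
  refine lt_of_le_of_lt (le_of_tendsto hr ?_) (h.quot_lt_of_pos hk ht (lt_add_one t))
  filter_upwards [eventually_gt_atTop (t + 1)] with s hs
  exact (h.quot_lt_of_pos hk (by linarith) hs).le

theorem lt_lim (h : IsFundamental k C C' S S') (hk : Disconjugate k)
    (hr : Tendsto (fun t => C t / S t) atTop (nhds r)) {t : ℝ} (ht : t < 0) : C t / S t < r := by
  refine (h.quot_lt_of_neg hk (sub_one_lt t) ht).trans_le ?_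
  refine ge_of_tendsto hr ?_
  filter_upwards [eventually_gt_atTop 0] with s hs
  exact (h.quot_lt_of_neg_of_pos hk (by linarith) hs).le

theorem limit_pos (h : IsFundamental k C C' S S') (hk : Disconjugate k)
    (hr : Tendsto (fun t => C t / S t) atTop (nhds r)) (t : ℝ) : 0 < C t - r * S t := by
  rcases lt_trichotomy t 0 with ht | rfl | ht
  · have := h.lt_lim hk hr ht
    rw [div_lt_iff_of_neg (h.S_neg hk ht)] at this
    linarith
  · simp [h.C0, h.S0]
  · have := h.lim_lt hk hr ht
    rw [lt_div_iff₀ (h.S_pos hk ht)] at this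
    linarith

theorem neg_lim_shift_eq (h : IsFundamental k C C' S S') (hk : Disconjugate k)
    (hr : Tendsto (fun t => C t / S t) atTop (nhds r)) {s r₁ : ℝ} {C₁ C₁' S₁ S₁' : ℝ → ℝ}
    (h₁ : IsFundamental (fun t => k (s + t)) C₁ C₁' S₁ S₁')
    (hr₁ : Tendsto (fun t => C₁ t / S₁ t) atTop (nhds r₁)) :
    -r₁ = (C' s - r * S' s) / (C s - r * S s) := by
  have l₁ : Tendsto (fun T => -(C₁ (T - s) / S₁ (T - s))) atTop (nhds (-r₁)) :=
    (hr₁.comp (tendsto_atTop_add_const_right atTop (-s) tendsto_id)).neg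
  have l₂ : Tendsto (fun T => (C' s - C T / S T * S' s) / (C s - C T / S T * S s)) atTop
      (nhds ((C' s - r * S' s) / (C s - r * S s))) :=
    ((hr.mul_const _).const_sub _).div ((hr.mul_const _).const_sub _) (h.limit_pos hk hr s).ne'
  refine tendsto_nhds_unique (l₁.congr' ?_) l₂
  filter_upwards [eventually_gt_atTop (max s 0)] with T hT
  have hT0 : T ≠ 0 := ((le_max_right _ _).trans_lt hT).ne'
  have hTs : 0 < T - s := sub_pos.2 ((le_max_left _ _).trans_lt hT)
  have hpos := h.sub_pos_of_zero hk hT0 (t := s) (fun hm => by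
    rw [uIcc, mem_Icc, sup_comm] at hm
    exact absurd hT (not_lt.2 hm.2))
  have e := h₁.eq_comb ((h.jac_sub (C T / S T)).shift s) (T - s)
  have hk₁ : Disconjugate (fun t => k (s + t)) := by
    intro J J' hJ ⟨t, ht⟩ a ha b hb
    have := hJ.shift (-s)
    simp only [add_neg_cancel_left] at this
    have := hk _ _ this ⟨t + s, by simpa using ht⟩ (a + s) (by simpa using ha)
      (b + s) (by simpa using hb)
    simpa using this
  have hS₁ := (h₁.S_pos hk₁ hTs).ne'
  have hST := h.S_ne_zero hk hT0
  simp only [add_sub_cancel, add_zero] at e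
  rw [div_mul_cancel₀ _ hST, sub_self] at e
  rw [← neg_div, div_eq_div_iff hS₁ hpos.ne']
  linarith

theorem hasDerivAt_riccati (h : IsFundamental k C C' S S') (hk : Disconjugate k)
    (hr : Tendsto (fun t => C t / S t) atTop (nhds r)) (t : ℝ) :
    HasDerivAt (fun t => (C' t - r * S' t) / (C t - r * S t))
      (-((C' t - r * S' t) / (C t - r * S t)) ^ 2 - k t) t := by
  have hpos := (h.limit_pos hk hr t).ne'
  refine ((h.jac_sub r t).2.div (h.jac_sub r t).1 hpos).congr_deriv ?_
  field_simp
  ring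

end IsFundamental

theorem exists_isFundamental {k : ℝ → ℝ} (hk : Continuous k) :
    ∃ C C' S S', IsFundamental k C C' S S' := by
  let A : ℝ → (ℝ × ℝ) →L[ℝ] (ℝ × ℝ) := fun t =>
    (ContinuousLinearMap.snd ℝ ℝ ℝ).prod 0 +
      k t • (0 : (ℝ × ℝ) →L[ℝ] ℝ).prod (-ContinuousLinearMap.fst ℝ ℝ ℝ)
  have hA : Continuous A := continuous_const.add (hk.smul continuous_const)
  have key : ∀ a b : ℝ, ∃ J J', IsJacobi k J J' ∧ J 0 = a ∧ J' 0 = b := by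
    intro a b
    obtain ⟨y, h0, hy⟩ := exists_linear_ODE_solution hA (a, b)
    refine ⟨fun t => (y t).1, fun t => (y t).2, fun t => ⟨?_, ?_⟩, by simp [h0], by simp [h0]⟩
    · exact (hasFDerivAt_fst.comp_hasDerivAt t (hy t)).congr_deriv (by simp [A])
    · exact (hasFDerivAt_snd.comp_hasDerivAt t (hy t)).congr_deriv (by simp [A])
  obtain ⟨C, C', hC, h1, h2⟩ := key 1 0
  obtain ⟨S, S', hS, h3, h4⟩ := key 0 1
  exact ⟨C, C', S, S', hC, hS, h1, h2, h3, h4⟩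

namespace RMetric

variable (M : RMetric)

theorem contDiff_dg (d i j : Fin 2) : ContDiff ℝ (⊤ : ℕ∞) (M.dg d i j) := by
  have : M.dg d i j = fun p => fderiv ℝ (fun p => M.g p i j) p (Pi.single d 1) := by
    funext p
    exact (((M.smooth i j).differentiable (by simp) p).lineDeriv_eq_fderiv)
  rw [this]
  exact ((M.smooth i j).fderiv_right (m := (⊤ : ℕ∞)) (by simp)).clm_apply contDiff_const

theorem det_eq (p : V2) : (M.g p).det = M.g p 0 0 * M.g p 1 1 - M.g p 0 1 * M.g p 1 0 :=
  Matrix.det_fin_two _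

theorem det_ne_zero (p : V2) : (M.g p).det ≠ 0 := (M.posDef p).det_pos.ne'

theorem contDiff_det : ContDiff ℝ (⊤ : ℕ∞) fun p => (M.g p).det := by
  simp only [det_eq]
  exact ((M.smooth _ _).mul (M.smooth _ _)).sub ((M.smooth _ _).mul (M.smooth _ _))

theorem contDiff_inv (i j : Fin 2) : ContDiff ℝ (⊤ : ℕ∞) fun p => (M.g p)⁻¹ i j := by
  have hd := M.contDiff_det.inv M.det_ne_zero
  have : ∀ p, (M.g p)⁻¹ = (M.g p).det⁻¹ • !![M.g p 1 1, -M.g p 0 1; -M.g p 1 0, M.g p 0 0] := by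
    intro p
    rw [Matrix.inv_def, Matrix.adjugate_fin_two, Ring.inverse_eq_inv']
  simp only [this, Matrix.smul_apply, smul_eq_mul]
  refine hd.mul ?_
  fin_cases i <;> fin_cases j <;> simp [M.smooth, (M.smooth _ _).neg]

theorem contDiff_Γ (k i j : Fin 2) : ContDiff ℝ (⊤ : ℕ∞) (M.Γ k i j) := by
  unfold Γ
  exact contDiff_const.mul (ContDiff.sum fun l _ => (M.contDiff_inv k l).mul
    (((M.contDiff_dg i j l).add (M.contDiff_dg j i l)).sub (M.contDiff_dg l i j)))

theorem contDiff_dΓ (d k i j : Fin 2) : ContDiff ℝ (⊤ : ℕ∞) (M.dΓ d k i j) := by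
  have : M.dΓ d k i j = fun p => fderiv ℝ (M.Γ k i j) p (Pi.single d 1) := by
    funext p
    exact (((M.contDiff_Γ k i j).differentiable (by simp) p).lineDeriv_eq_fderiv)
  rw [this]
  exact ((M.contDiff_Γ k i j).fderiv_right (m := (⊤ : ℕ∞)) (by simp)).clm_apply contDiff_const

theorem contDiff_K : ContDiff ℝ (⊤ : ℕ∞) M.K := by
  unfold K
  refine ContDiff.div (ContDiff.sum fun l _ => (M.smooth _ _).mul (((M.contDiff_dΓ _ _ _ _).sub
    (M.contDiff_dΓ _ _ _ _)).add (ContDiff.sum fun m _ => ?_))) M.contDiff_det M.det_ne_zero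
  exact ((M.contDiff_Γ _ _ _).mul (M.contDiff_Γ _ _ _)).sub
    ((M.contDiff_Γ _ _ _).mul (M.contDiff_Γ _ _ _))

/-- The geodesic vector field together with the Jacobi equation along it. -/
noncomputable def geodesicJacobiField (z : (V2 × V2) × (ℝ × ℝ)) : (V2 × V2) × (ℝ × ℝ) :=
  ((z.1.2, fun k => -∑ i, ∑ j, M.Γ k i j z.1.1 * z.1.2 i * z.1.2 j),
    (z.2.2, -(M.K z.1.1 * z.2.1)))

theorem locallyLipschitz_geodesicJacobiField : LocallyLipschitz M.geodesicJacobiField := by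
  refine ContDiff.locallyLipschitz (𝕂 := ℝ) ?_
  have hp : ContDiff ℝ 1 fun z : (V2 × V2) × (ℝ × ℝ) => z.1.1 := contDiff_fst.fst
  have hv : ContDiff ℝ 1 fun z : (V2 × V2) × (ℝ × ℝ) => z.1.2 := contDiff_fst.snd
  refine (hv.prodMk (contDiff_pi.2 fun k => (ContDiff.sum fun i _ => ContDiff.sum fun j _ =>
    ?_).neg)).prodMk
    (contDiff_snd.snd.prodMk ((((M.contDiff_K.of_le (by simp)).comp hp).mul contDiff_snd.fst).neg))
  exact ((((M.contDiff_Γ k i j).of_le (by simp)).comp hp).mul (contDiff_pi.1 hv i)).mul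
    (contDiff_pi.1 hv j)

theorem continuous_met : Continuous fun z : V2 × V2 => M.met z.1 z.2 z.2 := by
  unfold met
  have := fun i j => (M.smooth i j).continuous
  fun_prop

theorem isClosed_unitTangent : IsClosed M.UnitTangent :=
  isClosed_eq M.continuous_met continuous_const

theorem met_pos (p : V2) {v : V2} (hv : v ≠ 0) : 0 < M.met p v v := by
  have := (M.posDef p).dotProduct_mulVec_pos hv
  simp only [star_trivial, dotProduct, Matrix.mulVec, Fin.sum_univ_two] at this
  simp only [met, Fin.sum_univ_two]
  linarith

theorem isCompact_unitTangent_closedBall (R : ℝ) :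
    IsCompact (M.UnitTangent ∩ {z | ‖z.1‖ ≤ R}) := by
  have hS : IsCompact (Metric.closedBall (0 : V2) R ×ˢ Metric.sphere (0 : V2) 1) :=
    (isCompact_closedBall 0 R).prod (isCompact_sphere 0 1)
  obtain ⟨c, hc, hcS⟩ : ∃ c : ℝ, 0 < c ∧ ∀ z ∈ Metric.closedBall (0 : V2) R ×ˢ
      Metric.sphere (0 : V2) 1, c ≤ M.met z.1 z.2 z.2 :=
    hS.exists_forall_le' M.continuous_met.continuousOn fun z hz =>
      M.met_pos z.1 (by rintro h; simpa [h] using hz.2)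
  refine (((isCompact_closedBall (0 : V2) R).prod
    (isCompact_closedBall (0 : V2) (√(1 / c)))).of_isClosed_subset
    (M.isClosed_unitTangent.inter (isClosed_le continuous_fst.norm continuous_const)) ?_)
  rintro ⟨p, v⟩ ⟨h1, h2⟩
  refine ⟨by simpa using h2, ?_⟩
  rw [mem_closedBall_zero_iff]
  apply Real.le_sqrt_of_sq_le
  rw [le_div_iff₀ hc]
  rcases eq_or_ne v 0 with rfl | hv
  · simp
  have hv' : ‖v‖ ≠ 0 := norm_ne_zero_iff.2 hv
  have := hcS (p, ‖v‖⁻¹ • v) ⟨by simpa using h2, by simp [norm_smul, hv']⟩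
  have e : M.met p (‖v‖⁻¹ • v) (‖v‖⁻¹ • v) * ‖v‖ ^ 2 = M.met p v v := by
    simp only [met, Fin.sum_univ_two, Pi.smul_apply, smul_eq_mul]
    field_simp
  have h1' : M.met p v v = 1 := h1
  dsimp only at this
  nlinarith [sq_nonneg ‖v‖]

theorem sum_met_Γ (p : V2) (l i j : Fin 2) :
    ∑ k, M.g p l k * M.Γ k i j p = (M.dg i j l p + M.dg j i l p - M.dg l i j p) / 2 := by
  have h : M.g p * (M.g p)⁻¹ = 1 :=
    Matrix.mul_nonsing_inv _ (isUnit_iff_ne_zero.2 (M.det_ne_zero p))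
  have h' := fun a b => congrFun (congrFun h a) b
  simp only [Matrix.mul_apply, Fin.sum_univ_two] at h'
  have e : (1 : Matrix (Fin 2) (Fin 2) ℝ) l 0 * (M.dg i j 0 p + M.dg j i 0 p - M.dg 0 i j p) +
      (1 : Matrix (Fin 2) (Fin 2) ℝ) l 1 * (M.dg i j 1 p + M.dg j i 1 p - M.dg 1 i j p) =
      M.dg i j l p + M.dg j i l p - M.dg l i j p := by
    fin_cases l <;> simp [Matrix.one_apply]
  simp only [Γ, Fin.sum_univ_two]
  linear_combination (1 / 2) * (M.dg i j 0 p + M.dg j i 0 p - M.dg 0 i j p) * h' l 0 +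
    (1 / 2) * (M.dg i j 1 p + M.dg j i 1 p - M.dg 1 i j p) * h' l 1 + (1 / 2) * e

theorem hasDerivAt_g {γ : ℝ → V2} {γ' : V2} {t : ℝ} (h : HasDerivAt γ γ' t) (i j : Fin 2) :
    HasDerivAt (fun s => M.g (γ s) i j) (∑ d, M.dg d i j (γ t) * γ' d) t := by
  have hd := ((M.smooth i j).differentiable (by simp) (γ t))
  have e : ∀ d, M.dg d i j (γ t) = fderiv ℝ (fun p => M.g p i j) (γ t) (Pi.single d 1) := fun d =>
    hd.lineDeriv_eq_fderiv
  refine (hd.hasFDerivAt.comp_hasDerivAt t h).congr_deriv ?_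
  conv_lhs => rw [pi_eq_sum_univ' γ']
  simp [e, mul_comm]

variable {M} {γ : ℝ → V2}

theorem IsGeodesic.hasDerivAt (h : M.IsGeodesic γ) (t : ℝ) : HasDerivAt γ (vel γ t) t := by
  rw [hasDerivAt_pi]
  intro k
  exact ((contDiff_pi.1 h.1 k).differentiable (by simp) t).hasDerivAt

theorem IsGeodesic.hasDerivAt_vel (h : M.IsGeodesic γ) (t : ℝ) :
    HasDerivAt (vel γ) (fun k => -∑ i, ∑ j, M.Γ k i j (γ t) * vel γ t i * vel γ t j) t := by
  rw [hasDerivAt_pi]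
  intro k
  have hk : ContDiff ℝ 1 fun s => vel γ s k := by
    have : ContDiff ℝ (1 + 1) fun s => γ s k := contDiff_pi.1 h.1 k
    exact (contDiff_succ_iff_deriv.1 this).2.2
  refine (hk.differentiable (by simp) t).hasDerivAt.congr_deriv ?_
  have := h.2 t k
  simp only [acc] at this
  linarith

theorem IsGeodesic.met_vel (h : M.IsGeodesic γ) (t : ℝ) :
    M.met (γ t) (vel γ t) (vel γ t) = M.met (γ 0) (vel γ 0) (vel γ 0) := by
  have hd : ∀ t, HasDerivAt (fun t => M.met (γ t) (vel γ t) (vel γ t)) 0 t := by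
    intro t
    have hv := hasDerivAt_pi.1 (h.hasDerivAt_vel t)
    have hterm := HasDerivAt.fun_sum fun i (_ : i ∈ Finset.univ) => HasDerivAt.fun_sum
      fun j (_ : j ∈ Finset.univ) => ((M.hasDerivAt_g (h.hasDerivAt t) i j).mul (hv i)).mul (hv j)
    refine hterm.congr_deriv ?_
    have hs : M.g (γ t) 1 0 = M.g (γ t) 0 1 := (M.symm (γ t)).apply 0 1
    have hds : ∀ d, M.dg d 1 0 (γ t) = M.dg d 0 1 (γ t) := fun d => by
      unfold dg
      congr 1
      funext s
      exact (M.symm _).apply 0 1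
    have hΓ := fun l i j => M.sum_met_Γ (γ t) l i j
    simp only [Fin.sum_univ_two] at hΓ
    have h₀ := And.intro (And.intro (hΓ 0 0 0) (hΓ 0 0 1)) (And.intro (hΓ 0 1 0) (hΓ 0 1 1))
    have h₁ := And.intro (And.intro (hΓ 1 0 0) (hΓ 1 0 1)) (And.intro (hΓ 1 1 0) (hΓ 1 1 1))
    simp only [hs, hds] at h₀ h₁
    simp only [Fin.sum_univ_two, hs, hds, Pi.mul_apply]
    generalize vel γ t 0 = a
    generalize vel γ t 1 = b
    linear_combination
      -2 * a * (a * a * h₀.1.1 + a * b * h₀.1.2 + b * a * h₀.2.1 + b * b * h₀.2.2) -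
      2 * b * (a * a * h₁.1.1 + a * b * h₁.1.2 + b * a * h₁.2.1 + b * b * h₁.2.2)
  exact is_const_of_deriv_eq_zero (fun t => (hd t).differentiableAt) (fun t => (hd t).deriv) t 0

theorem NoConjugatePoints.disconjugate (hM : M.NoConjugatePoints) (h : M.IsGeodesic γ)
    (hu : M.UnitSpeed γ) : Disconjugate fun t => M.K (γ t) := by
  intro J J' hJ
  have e : deriv J = J' := funext fun t => (hJ t).1.deriv
  have e' : deriv J' = fun t => -(M.K (γ t) * J t) := funext fun t => (hJ t).2.deriv
  refine hM γ h hu J ?_ fun t => by rw [e, e']; ring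
  rw [show (2 : WithTop ℕ∞) = 1 + 1 by norm_num, contDiff_succ_iff_deriv]
  refine ⟨fun t => (hJ t).1.differentiableAt, by simp, ?_⟩
  rw [e, contDiff_one_iff_deriv]
  refine ⟨fun t => (hJ t).2.differentiableAt, ?_⟩
  rw [e']
  exact ((M.contDiff_K.continuous.comp h.1.continuous).mul hJ.continuous).neg

variable {Φ : V2 × V2 → ℝ → V2 × V2} {x : V2 × V2}

theorem IsGeodesicFlow.apply_eq (hΦ : M.IsGeodesicFlow Φ) (hx : x ∈ M.UnitTangent) (t : ℝ) :
    Φ x t = ((Φ x t).1, vel (fun s => (Φ x s).1) t) :=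
  Prod.ext rfl ((hΦ x hx).2.2 t)

theorem IsGeodesicFlow.mem_unitTangent (hΦ : M.IsGeodesicFlow Φ) (hx : x ∈ M.UnitTangent) (t : ℝ) :
    Φ x t ∈ M.UnitTangent := by
  have h := (hΦ x hx).2.1.met_vel t
  rw [← (hΦ x hx).2.2, ← (hΦ x hx).2.2, (hΦ x hx).1] at h
  exact h.trans hx

theorem IsGeodesicFlow.unitSpeed (hΦ : M.IsGeodesicFlow Φ) (hx : x ∈ M.UnitTangent) :
    M.UnitSpeed fun t => (Φ x t).1 := fun t => by
  have := hΦ.mem_unitTangent hx t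
  rwa [hΦ.apply_eq hx t] at this

theorem IsGeodesicFlow.hasDerivAt_jacobi (hΦ : M.IsGeodesicFlow Φ) (hx : x ∈ M.UnitTangent)
    {J J' : ℝ → ℝ} (hJ : IsJacobi (fun t => M.K (Φ x t).1) J J') (t : ℝ) :
    HasDerivAt (fun s => (Φ x s, (J s, J' s))) (M.geodesicJacobiField (Φ x t, (J t, J' t))) t := by
  have hg := (hΦ x hx).2.1
  have h := ((hg.hasDerivAt t).prodMk (hg.hasDerivAt_vel t)).prodMk ((hJ t).1.prodMk (hJ t).2)
  simp only [← hΦ.apply_eq hx] at h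
  refine h.congr_deriv ?_
  simp only [geodesicJacobiField, (hΦ x hx).2.2]

theorem IsGeodesicFlow.continuous_jacobi (hΦ : M.IsGeodesicFlow Φ) {J J' : M.UnitTangent → ℝ → ℝ}
    (hJ : ∀ x : M.UnitTangent, IsJacobi (fun t => M.K (Φ x t).1) (J x) (J' x)) {a b : ℝ}
    (ha : ∀ x, J x 0 = a) (hb : ∀ x, J' x 0 = b) :
    Continuous fun p : M.UnitTangent × ℝ => (Φ p.1 p.2, (J p.1 p.2, J' p.1 p.2)) := by
  refine continuous_of_autonomous M.locallyLipschitz_geodesicJacobiField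
    (y := fun (x : M.UnitTangent) t => (Φ x t, (J x t, J' x t)))
    (fun x => hΦ.hasDerivAt_jacobi x.2 (hJ x)) ?_
  simp only [ha, hb, (hΦ _ (Subtype.prop _)).1]
  exact continuous_subtype_val.prodMk continuous_const

theorem isJacobi_zero (k : ℝ → ℝ) : IsJacobi k (fun _ => 0) fun _ => 0 := fun t =>
  ⟨hasDerivAt_const t 0, (hasDerivAt_const t (0 : ℝ)).congr_deriv (by simp)⟩

theorem IsGeodesicFlow.add (hΦ : M.IsGeodesicFlow Φ) (hx : x ∈ M.UnitTangent) (s t : ℝ) :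
    Φ x (s + t) = Φ (Φ x s) t := by
  have hy := hΦ.mem_unitTangent hx s
  have h₁ := hΦ.hasDerivAt_jacobi hx (isJacobi_zero _)
  have h₂ := hΦ.hasDerivAt_jacobi hy (isJacobi_zero _)
  have := eq_of_autonomous M.locallyLipschitz_geodesicJacobiField
    (fun t => (h₁ (s + t)).comp_const_add s t) h₂ (by simp [(hΦ _ hy).1])
  exact congrArg Prod.fst (congrFun this t)

end RMetric
/-- **Lemma 2 (E. Hopf's construction).** On a complete plane without conjugate
points there is a Borel measurable, locally bounded `u : T¹ × ℝ → ℝ` solving the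
Riccati equation `u_v' + u_v² + K∘γ_v = 0` along each unit-speed geodesic and
invariant under the geodesic flow: `u(v, s+t) = u(Φ^s v, t)`. -/
theorem hopf_riccati_solution_exists (M : RMetric)
    (hcomp : M.Complete) (hconj : M.NoConjugatePoints)
    (Φ : V2 × V2 → ℝ → V2 × V2) (hΦ : M.IsGeodesicFlow Φ) :
    ∃ u : (V2 × V2) × ℝ → ℝ, M.IsHopfSolution Φ u := by
  have hdis : ∀ x : M.UnitTangent, Disconjugate fun t => M.K (Φ x t).1 := fun x =>
    hconj.disconjugate (hΦ x x.2).2.1 (hΦ.unitSpeed x.2)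
  choose C C' S S' hfund using fun x : M.UnitTangent =>
    exists_isFundamental (M.contDiff_K.continuous.comp (hΦ x x.2).2.1.1.continuous)
  replace hfund : ∀ x : M.UnitTangent,
    IsFundamental (fun t => M.K (Φ x t).1) (C x) (C' x) (S x) (S' x) := hfund
  choose r hr using fun x => (hfund x).exists_tendsto_quot (hdis x)
  have hcontC := hΦ.continuous_jacobi (fun x => (hfund x).jacC) (fun x => (hfund x).C0)
    fun x => (hfund x).C'0
  have hcontS := hΦ.continuous_jacobi (fun x => (hfund x).jacS) (fun x => (hfund x).S0)
    fun x => (hfund x).S'0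
  have hq : ∀ T : ℝ, T ≠ 0 → Continuous fun x => C x T / S x T := fun T hT =>
    (hcontC.snd.fst.comp (continuous_id.prodMk continuous_const)).div
      (hcontS.snd.fst.comp (continuous_id.prodMk continuous_const))
      fun x => (hfund x).S_ne_zero (hdis x) hT
  have hrm : Measurable r := by
    refine measurable_of_tendsto_metrizable (f := fun (n : ℕ) x => C x (n + 1) / S x (n + 1))
      (fun n => (hq _ (by positivity)).measurable) (tendsto_pi_nhds.2 fun x => ?_)
    exact (hr x).comp (tendsto_atTop_add_const_right _ 1 tendsto_natCast_atTop_atTop)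
  let φ : M.UnitTangent × ℝ → M.UnitTangent := fun p => ⟨Φ p.1 p.2, hΦ.mem_unitTangent p.1.2 p.2⟩
  have hφ : Continuous φ := hcontC.fst.subtype_mk _
  have hemb : MeasurableEmbedding fun p : M.UnitTangent × ℝ => ((p.1 : V2 × V2), p.2) :=
    (MeasurableEmbedding.subtype_coe M.isClosed_unitTangent.measurableSet).prodMap .id
  obtain ⟨u, hum, hu⟩ := hemb.exists_measurable_extend (hrm.comp hφ.measurable).neg fun _ => ⟨0⟩
  have hux : ∀ x (hx : x ∈ M.UnitTangent) t, u (x, t) = -r (φ (⟨x, hx⟩, t)) := fun x hx t =>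
    congrFun hu (⟨x, hx⟩, t)
  refine ⟨u, hum, fun R => ?_, fun x hx t => ?_, fun x hx s t => ?_⟩
  · have hcpt :
        IsCompact ((Subtype.val ⁻¹' {z | ‖z.1‖ ≤ R} : Set M.UnitTangent) ×ˢ Icc (-R) R) := by
      refine IsCompact.prod ?_ isCompact_Icc
      rw [Subtype.isCompact_iff, Subtype.image_preimage_coe]
      exact M.isCompact_unitTangent_closedBall R
    obtain ⟨A, hA⟩ := hcpt.exists_bound_of_continuousOn
      ((hq 1 one_ne_zero).comp hφ).continuousOn
    obtain ⟨B, hB⟩ := hcpt.exists_bound_of_continuousOn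
      ((hq (-1) (by norm_num)).comp hφ).continuousOn
    refine ⟨max A B, fun x hx hxR t ht => ?_⟩
    have hmem : ((⟨x, hx⟩, t) : M.UnitTangent × ℝ) ∈
        (Subtype.val ⁻¹' {z | ‖z.1‖ ≤ R} : Set M.UnitTangent) ×ˢ Icc (-R) R := ⟨hxR, abs_le.1 ht⟩
    have hA' := abs_le.1 (hA _ hmem)
    have hB' := abs_le.1 (hB _ hmem)
    have hlt := (hfund (φ (⟨x, hx⟩, t))).lim_lt (hdis _) (hr _) one_pos
    have hgt := (hfund (φ (⟨x, hx⟩, t))).lt_lim (hdis _) (hr _) neg_one_lt_zero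
    simp only [Function.comp_apply] at hA' hB'
    rw [hux x hx, abs_neg, abs_le]
    constructor
    · linarith [le_max_right A B]
    · linarith [le_max_left A B]
  · have hshift : ∀ t, u (x, t) = (C' ⟨x, hx⟩ t - r ⟨x, hx⟩ * S' ⟨x, hx⟩ t) /
        (C ⟨x, hx⟩ t - r ⟨x, hx⟩ * S ⟨x, hx⟩ t) := by
      intro t
      rw [hux x hx]
      have h := hfund (φ (⟨x, hx⟩, t))
      simp only [φ, ← hΦ.add hx] at h
      exact (hfund ⟨x, hx⟩).neg_lim_shift_eq (hdis _) (hr _) h (hr (φ (⟨x, hx⟩, t)))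
    simp only [hshift]
    exact (hfund ⟨x, hx⟩).hasDerivAt_riccati (hdis _) (hr _) t
  · rw [hux x hx, hux _ (hΦ.mem_unitTangent hx s)]
    congr 2
    exact Subtype.ext (hΦ.add hx s t)
end

section
/- Let A, F : (0,∞) → [0,∞) be non-decreasing and locally absolutely continuous, and suppose that R ∈ L¹_loc((0,∞),ℝ) satisfies ∫_0^r (∫_0^ρ R(t) dt) dρ ≤ A(r) for every r > 0. If a, b > 0 and c ∈ ℝ are constants such that the differential inequality F ≤ a·R + b·(F'·A')^{1/2} + c holds almost everywhere on (0,∞), then sup F ≤ 2a·liminf_{r→∞} A(r)/r² + c. -/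
open MeasureTheory Filter Set Real
open scoped ENNReal NNReal

/-- Integration by parts against the primitive of an integrable function, for a smooth kernel that
vanishes at the right endpoint. -/
lemma integral_mul_eq_neg_integral_deriv_mul_primitive {f k : ℝ → ℝ} {r : ℝ}
    (hf : IntervalIntegrable f volume 0 r) (hk : ContDiff ℝ 1 k) (hkr : k r = 0) :
    ∫ t in (0:ℝ)..r, k t * f t = -∫ ρ in (0:ℝ)..r, deriv k ρ * ∫ t in (0:ℝ)..ρ, f t := by
  have hH := hf.absolutelyContinuousOnInterval_intervalIntegral (c := 0) (by simp)
  have hkac : AbsolutelyContinuousOnInterval k 0 r :=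
    hk.contDiffOn.absolutelyContinuousOnInterval
  have h := hkac.integral_mul_deriv_eq_deriv_mul hH
  have hcongr : ∫ t in (0:ℝ)..r, k t * f t =
      ∫ t in (0:ℝ)..r, k t * deriv (fun ρ => ∫ t in (0:ℝ)..ρ, f t) t := by
    apply intervalIntegral.integral_congr_ae
    filter_upwards [hf.ae_hasDerivAt_integral] with x hx hxr
    rw [(hx (uIoc_subset_uIcc hxr) 0 (by simp)).deriv]
  rw [hcongr, h]
  simp [hkr]

lemma integral_sub_mul_eq_integral_primitive {f : ℝ → ℝ} {r : ℝ}
    (hf : IntervalIntegrable f volume 0 r) :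
    ∫ t in (0:ℝ)..r, (r - t) * f t = ∫ ρ in (0:ℝ)..r, ∫ t in (0:ℝ)..ρ, f t := by
  rw [integral_mul_eq_neg_integral_deriv_mul_primitive hf (by fun_prop) (sub_self r)]
  simp

lemma Monotone.intervalIntegral_deriv_le {f : ℝ → ℝ} (hf : Monotone f) {x y : ℝ} (hxy : x ≤ y) :
    ∫ t in x..y, deriv f t ≤ f y - f x := by
  have h := (hf.monotoneOn (uIcc x y)).intervalIntegral_deriv_mem_uIcc
  rw [uIcc_of_le (sub_nonneg.2 (hf hxy))] at h
  exact h.2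

lemma Monotone.intervalIntegrable_deriv {f : ℝ → ℝ} (hf : Monotone f) (x y : ℝ) :
    IntervalIntegrable (deriv f) volume x y :=
  (hf.monotoneOn (uIcc x y)).intervalIntegrable_deriv

lemma integral_sub_sq_mul_deriv_le {F : ℝ → ℝ} (hF : Monotone F) (hF0 : F 0 = 0) {r : ℝ}
    (hr : 0 ≤ r) :
    ∫ t in (0:ℝ)..r, (r - t) ^ 2 * deriv F t ≤ 2 * ∫ t in (0:ℝ)..r, (r - t) * F t := by
  have hint := hF.intervalIntegrable_deriv 0 r
  have hk : deriv (fun t : ℝ => (r - t) ^ 2) = fun t => -(2 * (r - t)) := by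
    ext t
    simpa using (((hasDerivAt_id t).const_sub r).fun_pow 2).deriv
  rw [integral_mul_eq_neg_integral_deriv_mul_primitive hint (by fun_prop) (by simp), hk,
    ← intervalIntegral.integral_neg, ← intervalIntegral.integral_const_mul]
  apply intervalIntegral.integral_mono_on hr
  · apply ContinuousOn.intervalIntegrable
    have := (hint.absolutelyContinuousOnInterval_intervalIntegral (c := 0) (by simp)).continuousOn
    fun_prop
  · exact (hF.intervalIntegrable.continuousOn_mul (by fun_prop)).const_mul 2
  · intro x hx
    have h1 := hF.intervalIntegral_deriv_le hx.1
    have h2 : 0 ≤ r - x := sub_nonneg.2 hx.2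
    nlinarith

lemma mul_mul_sqrt_mul_le {b x p q l : ℝ} (hp : 0 ≤ p) (hq : 0 ≤ q) (hl : 0 < l) :
    b * (x * √(p * q)) ≤ l * q + b ^ 2 / (4 * l) * (x ^ 2 * p) := by
  have h : l * q + b ^ 2 / (4 * l) * (x ^ 2 * p) - b * (x * √(p * q)) =
      (2 * l * √q - b * x * √p) ^ 2 / (4 * l) := by
    rw [Real.sqrt_mul hp]
    field_simp
    linear_combination (-4 * l ^ 2) * Real.sq_sqrt hq - b ^ 2 * x ^ 2 * Real.sq_sqrt hp
  have : 0 ≤ (2 * l * √q - b * x * √p) ^ 2 / (4 * l) := by positivity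
  linarith

section GrowthEstimate

variable {A F R : ℝ → ℝ} {a b c : ℝ}

/-- The differential inequality integrated twice, with the mixed term replaced by a majorant. -/
lemma integral_sub_mul_sub_const_le (hF : Monotone F)
    (hR : ∀ r > (0:ℝ), IntegrableOn R (Set.Ioc 0 r))
    (hRA : ∀ r > (0:ℝ), (∫ ρ in (0:ℝ)..r, ∫ t in (0:ℝ)..ρ, R t) ≤ A r) (ha : 0 < a)
    (hineq : ∀ᵐ t, 0 < t → F t ≤ a * R t + b * √(deriv F t * deriv A t) + c)
    {r : ℝ} (hr : 0 < r) {g : ℝ → ℝ} (hg : IntervalIntegrable g volume 0 r)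
    (hbg : ∀ t ∈ Set.Ioc 0 r, b * ((r - t) * √(deriv F t * deriv A t)) ≤ g t) :
    (∫ t in (0:ℝ)..r, (r - t) * F t) - c * r ^ 2 / 2 ≤ a * A r + ∫ t in (0:ℝ)..r, g t := by
  have hRi : IntervalIntegrable R volume 0 r :=
    (intervalIntegrable_iff_integrableOn_Ioc_of_le hr.le).2 (hR r hr)
  have hFi : IntervalIntegrable (fun t => (r - t) * F t) volume 0 r :=
    hF.intervalIntegrable.continuousOn_mul (by fun_prop)
  have hRi' : IntervalIntegrable (fun t => a * ((r - t) * R t)) volume 0 r :=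
    (hRi.continuousOn_mul (by fun_prop)).const_mul a
  have hci : IntervalIntegrable (fun t => c * (r - t)) volume 0 r :=
    Continuous.intervalIntegrable (by fun_prop) _ _
  have hmain : ∫ t in (0:ℝ)..r, (r - t) * F t ≤
      ∫ t in (0:ℝ)..r, (a * ((r - t) * R t) + g t + c * (r - t)) := by
    apply intervalIntegral.integral_mono_ae_restrict hr.le hFi ((hRi'.add hg).add hci)
    filter_upwards [ae_restrict_of_ae hineq, ae_restrict_of_ae (Measure.ae_ne volume 0),
      ae_restrict_mem measurableSet_Icc] with t ht ht0 htr
    have h : 0 < t := htr.1.lt_of_ne' ht0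
    have h1 := mul_le_mul_of_nonneg_left (ht h) (sub_nonneg.2 htr.2)
    have h2 := hbg t ⟨h, htr.2⟩
    linarith
  have hcint : ∫ t in (0:ℝ)..r, c * (r - t) = c * r ^ 2 / 2 := by
    simp [intervalIntegral.integral_comp_sub_left (fun x : ℝ => x)]
    ring
  rw [intervalIntegral.integral_add (hRi'.add hg) hci, intervalIntegral.integral_add hRi' hg,
    intervalIntegral.integral_const_mul, integral_sub_mul_eq_integral_primitive hRi, hcint] at hmain
  have := mul_le_mul_of_nonneg_left (hRA r hr) ha.le
  linarith

lemma mul_sq_le_integral_sub_mul (hF : Monotone F) (hF0 : F 0 = 0) {s r : ℝ} (hs : 0 ≤ s)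
    (hsr : s ≤ r) : F s * (r - s) ^ 2 / 2 ≤ ∫ t in (0:ℝ)..r, (r - t) * F t := by
  have hFi : ∀ x y, IntervalIntegrable (fun t => (r - t) * F t) volume x y := fun x y =>
    hF.intervalIntegrable.continuousOn_mul (by fun_prop)
  have h0 : 0 ≤ ∫ t in (0:ℝ)..s, (r - t) * F t :=
    intervalIntegral.integral_nonneg hs fun t ht =>
      mul_nonneg (by linarith [ht.2]) (hF0 ▸ hF ht.1)
  have h1 : ∫ t in s..r, (r - t) * F s ≤ ∫ t in s..r, (r - t) * F t :=
    intervalIntegral.integral_mono_on hsr (Continuous.intervalIntegrable (by fun_prop) _ _)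
      (hFi s r) fun t ht => mul_le_mul_of_nonneg_left (hF ht.1) (by linarith [ht.2])
  have h2 : ∫ t in s..r, (r - t) * F s = F s * (r - s) ^ 2 / 2 := by
    simp [intervalIntegral.integral_comp_sub_left (fun x : ℝ => x)]
    ring
  rw [← intervalIntegral.integral_add_adjacent_intervals (hFi 0 s) (hFi s r)]
  linarith

lemma bddAbove_range_of_frequently_le (hA : Monotone A) (hF : Monotone F) (hA0 : A 0 = 0)
    (hF0 : F 0 = 0) (hR : ∀ r > (0:ℝ), IntegrableOn R (Set.Ioc 0 r))
    (hRA : ∀ r > (0:ℝ), (∫ ρ in (0:ℝ)..r, ∫ t in (0:ℝ)..ρ, R t) ≤ A r)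
    (ha : 0 < a) (hb : 0 < b)
    (hineq : ∀ᵐ t, 0 < t → F t ≤ a * R t + b * √(deriv F t * deriv A t) + c)
    {l : ℝ} (hl : ∃ᶠ r in atTop, A r ≤ l * r ^ 2) : BddAbove (Set.range F) := by
  have key : ∀ r > (0:ℝ), A r ≤ l * r ^ 2 →
      ∫ t in (0:ℝ)..r, (r - t) * F t ≤ (2 * (a + b ^ 2) * l + c) * r ^ 2 := by
    intro r hr hAr
    have hAi := (hA.intervalIntegrable_deriv 0 r).const_mul (b ^ 2)
    have hFi : IntervalIntegrable (fun t => 1 / 4 * ((r - t) ^ 2 * deriv F t)) volume 0 r :=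
      ((hF.intervalIntegrable_deriv 0 r).continuousOn_mul (by fun_prop)).const_mul _
    have h := integral_sub_mul_sub_const_le hF hR hRA ha hineq hr (hAi.add hFi) fun t _ => by
      have h := mul_mul_sqrt_mul_le (b := b) (x := r - t) (l := b ^ 2) (hF.deriv_nonneg (x := t))
        (hA.deriv_nonneg (x := t)) (by positivity)
      rwa [show b ^ 2 / (4 * b ^ 2) = 1 / 4 by field_simp] at h
    rw [intervalIntegral.integral_add hAi hFi, intervalIntegral.integral_const_mul,
      intervalIntegral.integral_const_mul] at h
    have h1 := integral_sub_sq_mul_deriv_le hF hF0 hr.le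
    have h2 := mul_le_mul_of_nonneg_left (hA.intervalIntegral_deriv_le hr.le) (sq_nonneg b)
    have h3 := mul_le_mul_of_nonneg_left hAr (by positivity : 0 ≤ a + b ^ 2)
    rw [hA0] at h2
    linarith
  refine ⟨8 * (2 * (a + b ^ 2) * l + c), ?_⟩
  rintro _ ⟨s, rfl⟩
  obtain ⟨r, hAr, hr⟩ := (hl.and_eventually (eventually_ge_atTop (2 * max s 1))).exists
  have hs1 : 1 ≤ max s 1 := le_max_right _ _
  have h := (mul_sq_le_integral_sub_mul hF hF0 (by linarith : 0 ≤ max s 1) (by linarith)).trans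
    (key r (by linarith) hAr)
  have hFm : 0 ≤ F (max s 1) := hF0 ▸ hF (by linarith)
  have h1 : F (max s 1) * (r / 2) ^ 2 ≤ F (max s 1) * (r - max s 1) ^ 2 :=
    mul_le_mul_of_nonneg_left (pow_le_pow_left₀ (by linarith) (by linarith) 2) hFm
  have h2 : F (max s 1) * r ^ 2 ≤ 8 * (2 * (a + b ^ 2) * l + c) * r ^ 2 := by linarith
  exact (hF (le_max_left s 1)).trans (le_of_mul_le_mul_right h2 (by nlinarith))

lemma le_of_frequently_le (hA : Monotone A) (hF : Monotone F) (hA0 : A 0 = 0)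
    (hF0 : F 0 = 0) (hR : ∀ r > (0:ℝ), IntegrableOn R (Set.Ioc 0 r))
    (hRA : ∀ r > (0:ℝ), (∫ ρ in (0:ℝ)..r, ∫ t in (0:ℝ)..ρ, R t) ≤ A r)
    (ha : 0 < a) (hb : 0 < b)
    (hineq : ∀ᵐ t, 0 < t → F t ≤ a * R t + b * √(deriv F t * deriv A t) + c)
    {l : ℝ} (hl : ∃ᶠ r in atTop, A r ≤ l * r ^ 2) (x : ℝ) : F x ≤ 2 * a * l + c := by
  have hbdd := bddAbove_range_of_frequently_le hA hF hA0 hF0 hR hRA ha hb hineq hl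
  set M := ⨆ t, F t
  have hFM : ∀ t, F t ≤ M := le_ciSup hbdd
  have hlim : Tendsto F atTop (nhds M) := tendsto_atTop_ciSup hF hbdd
  have key : ∀ s > (0:ℝ), ∀ ε > (0:ℝ), ∀ r > s, A r ≤ l * r ^ 2 →
      F s * (r - s) ^ 2 / 2 - c * r ^ 2 / 2 ≤ a * (l * r ^ 2) +
        (r * A s + b ^ 2 / 4 * (r * F s) +
          (ε * (l * r ^ 2) + b ^ 2 / (4 * ε) * (r ^ 2 * (M - F s)))) := by
    intro s hs ε hε r hsr hAr
    have hr : 0 < r := hs.trans hsr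
    let g₁ : ℝ → ℝ := fun t => r * deriv A t + b ^ 2 / 4 * (r * deriv F t)
    let g₂ : ℝ → ℝ := fun t => ε * deriv A t + b ^ 2 / (4 * ε) * (r ^ 2 * deriv F t)
    have hi₁ : IntervalIntegrable g₁ volume 0 s :=
      ((hA.intervalIntegrable_deriv _ _).const_mul _).add
        (((hF.intervalIntegrable_deriv _ _).const_mul _).const_mul _)
    have hi₂ : IntervalIntegrable g₂ volume s r :=
      ((hA.intervalIntegrable_deriv _ _).const_mul _).add
        (((hF.intervalIntegrable_deriv _ _).const_mul _).const_mul _)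
    let g : ℝ → ℝ := fun t => if t ≤ s then g₁ t else g₂ t
    have hgg₁ : Set.EqOn g₁ g (Set.uIoc 0 s) := fun t ht => by
      rw [uIoc_of_le hs.le] at ht
      simp [g, ht.2]
    have hgg₂ : Set.EqOn g₂ g (Set.uIoc s r) := fun t ht => by
      rw [uIoc_of_le hsr.le] at ht
      simp [g, ht.1]
    have hig₁ := hi₁.congr hgg₁
    have hig₂ := hi₂.congr hgg₂
    have h := integral_sub_mul_sub_const_le hF hR hRA ha hineq hr (hig₁.trans hig₂) fun t ht => by
      have hF' : 0 ≤ deriv F t := hF.deriv_nonneg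
      have hA' : 0 ≤ deriv A t := hA.deriv_nonneg
      have hsq : (r - t) ^ 2 ≤ r ^ 2 :=
        pow_le_pow_left₀ (sub_nonneg.2 ht.2) (by linarith [ht.1]) 2
      by_cases hts : t ≤ s
      · simp only [g, if_pos hts, g₁]
        refine (mul_mul_sqrt_mul_le hF' hA' hr).trans ?_
        rw [show b ^ 2 / 4 * (r * deriv F t) = b ^ 2 / (4 * r) * (r ^ 2 * deriv F t) by
          field_simp]
        gcongr
      · simp only [g, if_neg hts, g₂]
        refine (mul_mul_sqrt_mul_le hF' hA' hε).trans ?_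
        gcongr
    have e₁ : ∫ t in (0:ℝ)..s, g t ≤ r * A s + b ^ 2 / 4 * (r * F s) := by
      have hAs := hA.intervalIntegral_deriv_le hs.le
      have hFs := hF.intervalIntegral_deriv_le hs.le
      rw [hA0, sub_zero] at hAs
      rw [hF0, sub_zero] at hFs
      rw [← intervalIntegral.integral_congr_ae (ae_of_all _ hgg₁), intervalIntegral.integral_add
        ((hA.intervalIntegrable_deriv _ _).const_mul _)
        (((hF.intervalIntegrable_deriv _ _).const_mul _).const_mul _)]
      simp only [intervalIntegral.integral_const_mul]
      gcongr
    have e₂ : ∫ t in s..r, g t ≤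
        ε * (l * r ^ 2) + b ^ 2 / (4 * ε) * (r ^ 2 * (M - F s)) := by
      have hAs := hA.intervalIntegral_deriv_le hsr.le
      have hFs := hF.intervalIntegral_deriv_le hsr.le
      have hAs0 : 0 ≤ A s := hA0 ▸ hA hs.le
      have hAs' : ∫ t in s..r, deriv A t ≤ l * r ^ 2 := by linarith
      have hFs' : ∫ t in s..r, deriv F t ≤ M - F s := by linarith [hFM r]
      rw [← intervalIntegral.integral_congr_ae (ae_of_all _ hgg₂), intervalIntegral.integral_add
        ((hA.intervalIntegrable_deriv _ _).const_mul _)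
        (((hF.intervalIntegrable_deriv _ _).const_mul _).const_mul _)]
      simp only [intervalIntegral.integral_const_mul]
      gcongr
    rw [← intervalIntegral.integral_add_adjacent_intervals hig₁ hig₂] at h
    have h₁ := mul_sq_le_integral_sub_mul hF hF0 hs.le hsr.le
    have h₂ := mul_le_mul_of_nonneg_left hAr ha.le
    linarith
  have key₂ : ∀ s > (0:ℝ), ∀ ε > (0:ℝ),
      F s / 2 - c / 2 ≤ a * l + (ε * l + b ^ 2 / (4 * ε) * (M - F s)) := by
    intro s hs ε hε
    have hinv : Tendsto (fun r : ℝ => r⁻¹) atTop (nhds 0) := tendsto_inv_atTop_zero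
    have hl₁ : Tendsto (fun r : ℝ => F s * (1 - s * r⁻¹) ^ 2 / 2 - c / 2) atTop
        (nhds (F s * (1 - s * 0) ^ 2 / 2 - c / 2)) :=
      ((((hinv.const_mul s).const_sub 1).pow 2).const_mul (F s)).div_const 2 |>.sub_const _
    have hl₂ : Tendsto (fun r : ℝ => a * l + ((A s + b ^ 2 / 4 * F s) * r⁻¹ +
          (ε * l + b ^ 2 / (4 * ε) * (M - F s)))) atTop
        (nhds (a * l + ((A s + b ^ 2 / 4 * F s) * 0 +
          (ε * l + b ^ 2 / (4 * ε) * (M - F s))))) :=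
      ((hinv.const_mul _).add_const _).const_add _
    have hle := le_of_tendsto_of_tendsto_of_frequently hl₁ hl₂
      ((hl.and_eventually (eventually_gt_atTop s)).mono fun r hr => by
        have h := key s hs ε hε r hr.2 hr.1
        have hr0 : 0 < r := hs.trans hr.2
        have e₁ : (F s * (1 - s * r⁻¹) ^ 2 / 2 - c / 2) * r ^ 2 =
            F s * (r - s) ^ 2 / 2 - c * r ^ 2 / 2 := by
          field_simp
        have e₂ : (a * l + ((A s + b ^ 2 / 4 * F s) * r⁻¹ +
            (ε * l + b ^ 2 / (4 * ε) * (M - F s)))) * r ^ 2 =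
            a * (l * r ^ 2) + (r * A s + b ^ 2 / 4 * (r * F s) +
              (ε * (l * r ^ 2) + b ^ 2 / (4 * ε) * (r ^ 2 * (M - F s)))) := by
          field_simp
        exact le_of_mul_le_mul_right (e₁.trans_le (h.trans_eq e₂.symm)) (pow_pos hr0 2))
    simpa using hle
  have key₃ : ∀ ε > (0:ℝ), M / 2 - c / 2 ≤ a * l + ε * l := by
    intro ε hε
    have h := le_of_tendsto_of_tendsto ((hlim.div_const 2).sub_const (c / 2))
      ((((hlim.const_sub M).const_mul (b ^ 2 / (4 * ε))).const_add (ε * l)).const_add (a * l))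
      ((eventually_gt_atTop 0).mono fun s hs => key₂ s hs ε hε)
    simpa using h
  have hM2 : M / 2 - c / 2 ≤ a * l := by
    have hl₃ : Tendsto (fun ε : ℝ => a * l + ε * l) (nhdsWithin 0 (Set.Ioi 0))
        (nhds (a * l + 0 * l)) :=
      (Continuous.tendsto (by fun_prop) 0).mono_left nhdsWithin_le_nhds
    have h := ge_of_tendsto hl₃ (eventually_mem_nhdsWithin.mono fun ε hε => key₃ ε hε)
    simpa using h
  linarith [hFM x]

end GrowthEstimate

/-- Extension by zero to the nonpositive half-line. -/
lemma monotone_indicator_Ioi {f : ℝ → ℝ} (hf : MonotoneOn f (Set.Ioi 0))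
    (h0 : ∀ r > (0:ℝ), 0 ≤ f r) : Monotone ((Set.Ioi (0:ℝ)).indicator f) := by
  intro x y hxy
  by_cases hx : 0 < x
  · have hy : 0 < y := hx.trans_le hxy
    simpa [Set.indicator, hx, hy] using hf hx hy hxy
  · rw [Set.indicator_of_notMem (by simpa using hx)]
    exact Set.indicator_nonneg h0 y

lemma deriv_indicator_Ioi (f : ℝ → ℝ) {t : ℝ} (ht : 0 < t) :
    deriv ((Set.Ioi (0:ℝ)).indicator f) t = deriv f t := by
  apply Filter.EventuallyEq.deriv_eq
  filter_upwards [Ioi_mem_nhds ht] with x hx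
  exact Set.indicator_of_mem hx f

/-- **Lemma 3 (sharp growth estimate for an ODE inequality).** If `A, F` are
non-decreasing, non-negative, locally absolutely continuous on `(0,∞)`,
`R ∈ L¹_loc` satisfies `∫₀^r ∫₀^ρ R ≤ A(r)`, and a.e.
`F ≤ a R + b (F' A')^{1/2} + c` with `a, b > 0`, then
`sup F ≤ 2a liminf_{r→∞} A(r)/r² + c`. -/
theorem ode_growth_estimate (A F : ℝ → ℝ)
    (hA0 : ∀ r > (0:ℝ), 0 ≤ A r) (hF0 : ∀ r > (0:ℝ), 0 ≤ F r)
    (hAmono : MonotoneOn A (Set.Ioi 0)) (hFmono : MonotoneOn F (Set.Ioi 0))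
    (hAac : LocAbsContOn A (Set.Ioi 0)) (hFac : LocAbsContOn F (Set.Ioi 0))
    (R : ℝ → ℝ) (hR : ∀ r > (0:ℝ), IntegrableOn R (Set.Ioc 0 r))
    (hRA : ∀ r > (0:ℝ), (∫ ρ in (0:ℝ)..r, ∫ t in (0:ℝ)..ρ, R t) ≤ A r)
    (a b c : ℝ) (ha : 0 < a) (hb : 0 < b)
    (hineq : ∀ᵐ r ∂(volume.restrict (Set.Ioi (0:ℝ))),
      F r ≤ a * R r + b * Real.sqrt (deriv F r * deriv A r) + c) :
    ⨆ r ∈ Set.Ioi (0:ℝ), (F r : EReal) ≤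
      ((2 * a : ℝ) : EReal) *
          Filter.liminf (fun r : ℝ => ((A r / r ^ 2 : ℝ) : EReal)) atTop +
        (c : EReal) := by
  have hApos : ∀ r > (0:ℝ), (Set.Ioi (0:ℝ)).indicator A r = A r := fun r hr =>
    Set.indicator_of_mem (Set.mem_Ioi.2 hr) A
  have hFpos : ∀ r > (0:ℝ), (Set.Ioi (0:ℝ)).indicator F r = F r := fun r hr =>
    Set.indicator_of_mem (Set.mem_Ioi.2 hr) F
  have key : ∀ l : ℝ, (∃ᶠ r in atTop, A r ≤ l * r ^ 2) → ∀ x > (0:ℝ), F x ≤ 2 * a * l + c := by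
    intro l hl x hx
    rw [← hFpos x hx]
    refine le_of_frequently_le (monotone_indicator_Ioi hAmono hA0)
      (monotone_indicator_Ioi hFmono hF0) (by simp) (by simp) hR
      (fun r hr => (hRA r hr).trans_eq (hApos r hr).symm) ha hb ?_ ?_ x
    · filter_upwards [(ae_restrict_iff' measurableSet_Ioi).1 hineq] with t ht ht0
      rw [hFpos t ht0, deriv_indicator_Ioi F ht0, deriv_indicator_Ioi A ht0]
      exact ht ht0
    · exact (hl.and_eventually (eventually_gt_atTop 0)).mono fun r hr =>
        (hApos r hr.2).trans_le hr.1
  refine iSup₂_le fun x hx => ?_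
  set L := Filter.liminf (fun r : ℝ => ((A r / r ^ 2 : ℝ) : EReal)) atTop
  have hlt : ∀ l : ℝ, L < l → F x ≤ 2 * a * l + c := by
    intro l hLl
    refine key l ?_ x hx
    have hfreq := frequently_lt_of_liminf_lt (by isBoundedDefault) hLl
    refine (hfreq.and_eventually (eventually_gt_atTop 0)).mono fun r hr => ?_
    exact ((div_lt_iff₀ (pow_pos hr.2 2)).1 (EReal.coe_lt_coe_iff.1 hr.1)).le
  have hL0 : (0 : EReal) ≤ L :=
    le_liminf_of_le (by isBoundedDefault) <| (eventually_gt_atTop 0).mono fun r hr =>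
      EReal.coe_nonneg.2 (div_nonneg (hA0 r hr) (sq_nonneg r))
  clear_value L
  induction L with
  | bot => simp at hL0
  | top =>
    rw [EReal.coe_mul_top_of_pos (by positivity), EReal.top_add_coe]
    exact le_top
  | coe L₀ =>
    have hlim : Tendsto (fun l : ℝ => 2 * a * l + c) (nhdsWithin L₀ (Set.Ioi L₀))
        (nhds (2 * a * L₀ + c)) :=
      (Continuous.tendsto (by fun_prop) L₀).mono_left nhdsWithin_le_nhds
    have h := ge_of_tendsto hlim (eventually_mem_nhdsWithin.mono fun l hl =>
      hlt l (EReal.coe_lt_coe_iff.2 hl))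
    exact_mod_cast h
end

section
/- Let F, A : (0,∞) → [0,∞) be non-decreasing and locally absolutely continuous, let 0 < q < r, and set I(q,r) := ∫_q^r (∫_q^ρ (F(t) − F(q)) dt) dρ. Then ∫_q^r (∫_q^ρ (F'(t)·A'(t))^{1/2} dt) dρ ≤ (2·I(q,r)·A(r))^{1/2}. -/
open MeasureTheory Filter Set Real
open scoped ENNReal NNReal

theorem intervalIntegral_primitive_mul_deriv {f w : ℝ → ℝ} {a b : ℝ}
    (hf : IntervalIntegrable f volume a b) (hw : ContDiff ℝ 1 w) (hwb : w b = 0) :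
    ∫ x in a..b, (∫ t in a..x, f t) * deriv w x = -∫ x in a..b, f x * w x := by
  have hac := hf.absolutelyContinuousOnInterval_intervalIntegral (c := a) (by simp)
  rw [hac.integral_mul_deriv_eq_deriv_mul hw.contDiffOn.absolutelyContinuousOnInterval]
  simp only [hwb, mul_zero, intervalIntegral.integral_same, zero_mul, sub_zero, zero_sub]
  congr 1
  apply intervalIntegral.integral_congr_ae
  filter_upwards [hf.ae_hasDerivAt_integral] with x hx hxab
  rw [(hx (uIoc_subset_uIcc hxab) a (by simp)).deriv]

theorem intervalIntegral_primitive {f : ℝ → ℝ} {a b : ℝ}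
    (hf : IntervalIntegrable f volume a b) :
    ∫ x in a..b, ∫ t in a..x, f t = ∫ x in a..b, (b - x) * f x := by
  have h := intervalIntegral_primitive_mul_deriv (w := fun x => x - b) hf (by fun_prop) (by simp)
  simp only [deriv_sub_const_fun, deriv_id'', mul_one] at h
  rw [h, ← intervalIntegral.integral_neg]
  congr 1; ext x; ring

theorem intervalIntegral_sq_mul {f : ℝ → ℝ} {a b : ℝ}
    (hf : IntervalIntegrable f volume a b) :
    ∫ x in a..b, (b - x) ^ 2 * f x = 2 * ∫ x in a..b, (b - x) * ∫ t in a..x, f t := by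
  have hw (x : ℝ) : deriv (fun x : ℝ => -(b - x) ^ 2) x = 2 * (b - x) := by
    have h := (((hasDerivAt_id x).const_sub b).pow 2).neg
    simpa [Pi.pow_def] using h.deriv
  have h := intervalIntegral_primitive_mul_deriv (w := fun x => -(b - x) ^ 2) hf (by fun_prop)
    (by simp)
  simp only [hw] at h
  rw [← intervalIntegral.integral_neg] at h
  rw [← intervalIntegral.integral_const_mul]
  rw [show (fun x => (b - x) ^ 2 * f x) = fun x => -(f x * -(b - x) ^ 2) by ext x; ring, ← h]
  congr 1; ext x; ring

theorem intervalIntegral_deriv_le_sub_of_monotoneOn {f : ℝ → ℝ} {a b : ℝ} (hab : a ≤ b)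
    (hf : MonotoneOn f (Icc a b)) : ∫ x in a..b, deriv f x ≤ f b - f a := by
  have h := (uIcc_of_le hab ▸ hf : MonotoneOn f (uIcc a b)).intervalIntegral_deriv_mem_uIcc
  rw [uIcc_of_le (sub_nonneg.2 (hf (left_mem_Icc.2 hab) (right_mem_Icc.2 hab) hab))] at h
  exact h.2

theorem deriv_nonneg_of_monotoneOn_isOpen {f : ℝ → ℝ} {s : Set ℝ} {x : ℝ} (hs : IsOpen s)
    (hf : MonotoneOn f s) (hx : x ∈ s) : 0 ≤ deriv f x := by
  rw [← derivWithin_of_isOpen hs hx]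
  exact hf.derivWithin_nonneg

theorem intervalIntegral_sq_mul_deriv_le {f : ℝ → ℝ} {a b : ℝ} (hab : a ≤ b)
    (hf : MonotoneOn f (Icc a b)) :
    ∫ x in a..b, (b - x) ^ 2 * deriv f x ≤ 2 * ∫ x in a..b, ∫ t in a..x, (f t - f a) := by
  have hfu : MonotoneOn f (uIcc a b) := by rwa [uIcc_of_le hab]
  have hd := hfu.intervalIntegrable_deriv
  have hsub : IntervalIntegrable (fun t => f t - f a) volume a b :=
    hfu.intervalIntegrable.sub intervalIntegrable_const
  have hlin : ContinuousOn (fun x : ℝ => b - x) (uIcc a b) := by fun_prop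
  rw [intervalIntegral_sq_mul hd, intervalIntegral_primitive hsub]
  gcongr
  refine intervalIntegral.integral_mono_on hab ?_ (hsub.continuousOn_mul hlin) fun x hx => ?_
  · exact (hlin.mul (hd.absolutelyContinuousOnInterval_intervalIntegral (c := a)
      (by simp)).continuousOn).intervalIntegrable
  · exact mul_le_mul_of_nonneg_left
      (intervalIntegral_deriv_le_sub_of_monotoneOn hx.1 (hf.mono (Icc_subset_Icc_right hx.2)))
      (sub_nonneg.2 hx.2)

theorem intervalIntegrable_sqrt_mul {u v : ℝ → ℝ} {a b : ℝ} (hab : a ≤ b)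
    (hu : IntervalIntegrable u volume a b) (hv : IntervalIntegrable v volume a b)
    (hu0 : ∀ x ∈ Icc a b, 0 ≤ u x) (hv0 : ∀ x ∈ Icc a b, 0 ≤ v x) :
    IntervalIntegrable (fun x => √(u x * v x)) volume a b := by
  refine (hu.add hv).mono_fun ?_ ?_
  · exact continuous_sqrt.comp_aestronglyMeasurable
      (hu.def'.aestronglyMeasurable.mul hv.def'.aestronglyMeasurable)
  · refine (ae_restrict_iff' measurableSet_uIoc).2 (.of_forall fun x hx => ?_)
    have hx' : x ∈ Icc a b := by rw [← uIcc_of_le hab]; exact uIoc_subset_uIcc hx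
    have h1 := hu0 x hx'
    have h2 := hv0 x hx'
    simp only [norm_eq_abs, abs_of_nonneg (sqrt_nonneg _), abs_of_nonneg (add_nonneg h1 h2)]
    exact sqrt_le_iff.2 ⟨by positivity, by nlinarith [mul_nonneg h1 h2]⟩

theorem intervalIntegral_mul_sqrt_mul_sq_le {u v w : ℝ → ℝ} {a b : ℝ} (hab : a ≤ b)
    (hw : ContinuousOn w (uIcc a b))
    (hu : IntervalIntegrable u volume a b) (hv : IntervalIntegrable v volume a b)
    (hu0 : ∀ x ∈ Icc a b, 0 ≤ u x) (hv0 : ∀ x ∈ Icc a b, 0 ≤ v x) :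
    (∫ x in a..b, w x * √(u x * v x)) ^ 2 ≤
      (∫ x in a..b, w x ^ 2 * u x) * ∫ x in a..b, v x := by
  set X := ∫ x in a..b, w x * √(u x * v x) with hX
  set S := ∫ x in a..b, w x ^ 2 * u x with hS
  set T := ∫ x in a..b, v x with hT
  have h (c : ℝ) : 0 ≤ S * (c * c) + (-2 * X) * c + T := by
    have h1 : IntervalIntegrable (fun x => w x ^ 2 * u x * (c * c)) volume a b :=
      (hu.continuousOn_mul (hw.pow 2)).mul_const (c * c)
    have h2 := (((intervalIntegrable_sqrt_mul hab hu hv hu0 hv0).continuousOn_mul hw).const_mul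
      (-2)).mul_const c
    rw [hX, hS, hT, ← intervalIntegral.integral_const_mul, ← intervalIntegral.integral_mul_const,
      ← intervalIntegral.integral_mul_const, ← intervalIntegral.integral_add h1 h2,
      ← intervalIntegral.integral_add (h1.add h2) hv]
    refine intervalIntegral.integral_nonneg hab fun x hx => ?_
    have hux := hu0 x hx
    have hvx := hv0 x hx
    rw [sqrt_mul hux]
    calc 0 ≤ (c * w x * √(u x) - √(v x)) ^ 2 := sq_nonneg _
      _ = w x ^ 2 * √(u x) ^ 2 * (c * c) + -2 * (w x * (√(u x) * √(v x))) * c + √(v x) ^ 2 := by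
        ring
      _ = _ := by rw [sq_sqrt hux, sq_sqrt hvx]
  have := discrim_le_zero h
  rw [discrim] at this
  linarith

/-- **Inequality (4.1).** For non-decreasing, non-negative, locally absolutely
continuous `F, A` on `(0,∞)` and `0 < q < r`, with
`I(q,r) = ∫_q^r ∫_q^ρ (F(t) - F(q)) dt dρ`,
`∫_q^r ∫_q^ρ (F'A')^{1/2} dt dρ ≤ (2 I(q,r) A(r))^{1/2}`. -/
theorem sqrt_double_integral_estimate (F A : ℝ → ℝ)
    (hF0 : ∀ r > (0:ℝ), 0 ≤ F r) (hA0 : ∀ r > (0:ℝ), 0 ≤ A r)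
    (hFmono : MonotoneOn F (Set.Ioi 0)) (hAmono : MonotoneOn A (Set.Ioi 0))
    (hFac : LocAbsContOn F (Set.Ioi 0)) (hAac : LocAbsContOn A (Set.Ioi 0))
    (q r : ℝ) (hq : 0 < q) (hqr : q < r) :
    (∫ ρ in q..r, ∫ t in q..ρ, Real.sqrt (deriv F t * deriv A t)) ≤
      Real.sqrt (2 * (∫ ρ in q..r, ∫ t in q..ρ, (F t - F q)) * A r) := by
  have hsub : Icc q r ⊆ Ioi 0 := fun x hx => hq.trans_le hx.1
  have hF := hFmono.mono hsub
  have hA := hAmono.mono hsub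
  have hFd : IntervalIntegrable (deriv F) volume q r :=
    MonotoneOn.intervalIntegrable_deriv (by rwa [uIcc_of_le hqr.le])
  have hAd : IntervalIntegrable (deriv A) volume q r :=
    MonotoneOn.intervalIntegrable_deriv (by rwa [uIcc_of_le hqr.le])
  have hFd0 : ∀ x ∈ Icc q r, 0 ≤ deriv F x := fun x hx =>
    deriv_nonneg_of_monotoneOn_isOpen isOpen_Ioi hFmono (hsub hx)
  have hAd0 : ∀ x ∈ Icc q r, 0 ≤ deriv A x := fun x hx =>
    deriv_nonneg_of_monotoneOn_isOpen isOpen_Ioi hAmono (hsub hx)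
  rw [intervalIntegral_primitive (intervalIntegrable_sqrt_mul hqr.le hFd hAd hFd0 hAd0)]
  apply le_sqrt_of_sq_le
  have hFle := intervalIntegral_sq_mul_deriv_le hqr.le hF
  have hFnonneg : 0 ≤ ∫ x in q..r, (r - x) ^ 2 * deriv F x :=
    intervalIntegral.integral_nonneg hqr.le fun x hx => mul_nonneg (sq_nonneg _) (hFd0 x hx)
  have hAle : ∫ x in q..r, deriv A x ≤ A r := by
    linarith [intervalIntegral_deriv_le_sub_of_monotoneOn hqr.le hA, hA0 q hq]
  calc _ ≤ (∫ x in q..r, (r - x) ^ 2 * deriv F x) * ∫ x in q..r, deriv A x :=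
        intervalIntegral_mul_sqrt_mul_sq_le hqr.le (by fun_prop) hFd hAd hFd0 hAd0
    _ ≤ _ := mul_le_mul hFle hAle (intervalIntegral.integral_nonneg hqr.le hAd0)
        (hFnonneg.trans hFle)
end
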